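/- Let T = T_1 ⊕ ⋯ ⊕ T_r be a basic support tilting object in rep Q, supported on the vertices numbered n−r+1, …, n. Define θ = Σ_{i=1}^r a_i d_i + Σ_{j=1}^{n−r} b_j e_j on K_0(kQ), where d_i(dim M) = dim Hom(T_i, M) − dim Ext^1(T_i, M) and e_j(dim M) = dim_k M_j, with a_i = 0 whenever T_i is split projective in Gen T, a_i > 0 whenever T_i is Ext-projective but not split projective, and b_j < 0 for all j. Then the wide subcategory a(Gen T) equals the category θ_ss of θ-semistable representations. In particular, every finitely generated wide subcategory of rep Q is the semistable subcategory of some stability condition. -/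

import Mathlib

open CategoryTheory CategoryTheory.Limits ZeroObject

attribute [local instance] CategoryTheory.Abelian.hasFiniteBiproducts

noncomputable section

namespace NCPaper

/-- A finite quiver without oriented cycles. -/
structure FinQuiver : Type 1 where
  V : Type
  [quiver : Quiver.{0} V]
  [fintypeV : Fintype V]
  [fintypeArr : ∀ a b : V, Fintype (a ⟶ b)]
  acyclic : ∀ (v : V) (p : Quiver.Path v v), p = Quiver.Path.nil

attribute [instance] FinQuiver.quiver FinQuiver.fintypeV FinQuiver.fintypeArr

variable (k : Type) [Field k] (Q : FinQuiver)

/-- The ambient abelian category of all `k`-linear representations of `Q`;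
finite-dimensional representations are singled out by the predicate `FinDim`. -/
abbrev RepC : Type 1 := Paths Q.V ⥤ ModuleCat.{0} k

variable {k Q}

/-- `M` is a finite-dimensional representation, i.e. an object of `rep Q`. -/
def FinDim (M : RepC k Q) : Prop :=
  ∀ v : Q.V, FiniteDimensional k (M.obj ((Paths.of Q.V).obj v))

section Cat

variable {C : Type*} [Category C] [Abelian C]

/-- `X` is a direct summand of `A`. -/
def IsSummand (X A : C) : Prop := ∃ (i : X ⟶ A) (r : A ⟶ X), i ≫ r = 𝟙 X

/-- The additive closure of a set of objects: direct summands of finite direct sums. -/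
def addSet (S : Set C) : Set C :=
  { X | ∃ (n : ℕ) (f : Fin n → C), (∀ i, f i ∈ S) ∧ IsSummand X (⨁ f) }

/-- `Gen S`: all quotients of objects of the additive closure of `S`. -/
def gen (S : Set C) : Set C := { X | ∃ A ∈ addSet S, ∃ p : A ⟶ X, Epi p }

/-- All morphisms from `A` to `B` vanish. -/
def HomZero (A B : C) : Prop := ∀ f : A ⟶ B, f = 0

/-- `Ext¹(A, B) = 0`, expressed by the splitting of all short exact sequences
`0 ⟶ B ⟶ E ⟶ A ⟶ 0`. -/
def Ext1Zero (A B : C) : Prop :=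
  ∀ (E : C) (i : B ⟶ E) (p : E ⟶ A) (w : i ≫ p = 0),
    (ShortComplex.mk i p w).ShortExact → ∃ r : E ⟶ B, i ≫ r = 𝟙 B

/-- An indecomposable object. -/
def Indec (X : C) : Prop :=
  ¬ IsZero X ∧ ∀ (A B : C), (X ≅ A ⊞ B) → IsZero A ∨ IsZero B

/-- A torsion class: a full subcategory (identified with its set of objects) closed under
direct sums, direct summands, quotients and extensions. -/
structure IsTorsionClass (T : Set C) : Prop where
  zero_mem : (0 : C) ∈ T
  sum_mem : ∀ X ∈ T, ∀ Y ∈ T, (X ⊞ Y : C) ∈ T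
  summand_mem : ∀ X ∈ T, ∀ Y : C, IsSummand Y X → Y ∈ T
  quot_mem : ∀ X ∈ T, ∀ (Y : C) (p : X ⟶ Y), Epi p → Y ∈ T
  ext_mem : ∀ S : ShortComplex C, S.ShortExact → S.X₁ ∈ T → S.X₃ ∈ T → S.X₂ ∈ T

/-- A wide subcategory: a full subcategory (closed under direct sums and summands)
which is exact abelian (closed under kernels and cokernels) and closed under extensions. -/
structure IsWide (A : Set C) : Prop where
  zero_mem : (0 : C) ∈ A
  sum_mem : ∀ X ∈ A, ∀ Y ∈ A, (X ⊞ Y : C) ∈ A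
  summand_mem : ∀ X ∈ A, ∀ Y : C, IsSummand Y X → Y ∈ A
  ker_mem : ∀ X ∈ A, ∀ Y ∈ A, ∀ f : X ⟶ Y, (kernel f : C) ∈ A
  coker_mem : ∀ X ∈ A, ∀ Y ∈ A, ∀ f : X ⟶ Y, (cokernel f : C) ∈ A
  ext_mem : ∀ S : ShortComplex C, S.ShortExact → S.X₁ ∈ A → S.X₃ ∈ A → S.X₂ ∈ A

/-- `P` is split projective in the subcategory `T`: every epimorphism onto `P`
from an object of `T` splits. -/
def SplitProjIn (T : Set C) (P : C) : Prop :=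
  P ∈ T ∧ ∀ X ∈ T, ∀ p : X ⟶ P, Epi p → ∃ s : P ⟶ X, s ≫ p = 𝟙 P

/-- `P` is Ext-projective in the subcategory `T`. -/
def ExtProjIn (T : Set C) (P : C) : Prop := P ∈ T ∧ ∀ X ∈ T, Ext1Zero P X

/-- The subcategory `a(T)` associated to a torsion class `T`. -/
def aSet (T : Set C) : Set C :=
  { B | B ∈ T ∧ ∀ Y ∈ T, ∀ g : Y ⟶ B, (kernel g : C) ∈ T }

/-- A subcategory is finitely generated if it is generated by a single object of it. -/
def IsFinGen (T : Set C) : Prop := ∃ U ∈ T, T ⊆ gen {U}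

/-- `U` is a generator of the subcategory `T`. -/
def IsGenerator (T : Set C) (U : C) : Prop := U ∈ T ∧ T ⊆ gen {U}

/-- `X` is a subquotient of `M`. -/
def IsSubquotient (X M : C) : Prop := ∃ (N : C) (i : N ⟶ M) (p : N ⟶ X), Mono i ∧ Epi p

/-- The support of `M` is contained in the support of `C0`: every simple subquotient
(composition factor) of `M` is a composition factor of `C0`. -/
def SuppLE (M C0 : C) : Prop := ∀ S : C, Simple S → IsSubquotient S M → IsSubquotient S C0

/-- A partial tilting object of a hereditary category. -/
def IsPartialTilting (T : C) : Prop := Ext1Zero T T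

/-- `T` is a tilting object of the full subcategory `A`: it is self-orthogonal and every
(split) projective object of `A` admits a coresolution `0 ⟶ P ⟶ T' ⟶ T'' ⟶ 0` with
`T', T'' ∈ add T`. For `A` the subcategory of representations supported on `supp T`,
this says exactly that `T` is a tilting `kQ/ann T`-module. -/
def TiltingIn (A : Set C) (T : C) : Prop :=
  T ∈ A ∧ Ext1Zero T T ∧
    ∀ P : C, SplitProjIn A P →
      ∃ (T' T'' : C) (_ : T' ∈ addSet {T}) (_ : T'' ∈ addSet {T})
        (i : P ⟶ T') (p : T' ⟶ T'') (w : i ≫ p = 0),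
        (ShortComplex.mk i p w).ShortExact


/-- `U` is the direct sum of one representative of each isomorphism class of
indecomposable Ext-projective objects of `T`. -/
def IsExtProjSum (T : Set C) (U : C) : Prop :=
  ∃ (n : ℕ) (f : Fin n → C),
    (∀ i, Indec (f i) ∧ ExtProjIn T (f i)) ∧
    (∀ i j, Nonempty (f i ≅ f j) → i = j) ∧
    (∀ P : C, Indec P → ExtProjIn T P → ∃ i, Nonempty (P ≅ f i)) ∧
    Nonempty (U ≅ ⨁ f)

/-- A basic object: a direct sum of pairwise non-isomorphic indecomposables. -/
def IsBasic (U : C) : Prop :=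
  ∃ (n : ℕ) (f : Fin n → C), (∀ i, Indec (f i)) ∧
    (∀ i j, Nonempty (f i ≅ f j) → i = j) ∧ Nonempty (U ≅ ⨁ f)

end Cat

/-- A support tilting object of `rep Q`: partial tilting, and tilting as a
`kQ/ann T`-module, i.e. tilting in the subcategory of all finite-dimensional
representations supported on the support of `T`. -/
def IsSupportTilting {k : Type} [Field k] {Q : FinQuiver} (T : RepC k Q) : Prop :=
  IsPartialTilting T ∧ TiltingIn { M : RepC k Q | FinDim M ∧ SuppLE M T } T

section Comb

/-- The dimension vector of a representation. -/
def dimVec {k : Type} [Field k] {Q : FinQuiver} (M : RepC k Q) : Q.V → ℤ :=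
  fun v => (Module.finrank k (M.obj ((Paths.of Q.V).obj v)) : ℤ)

/-- The Euler form of the quiver `Q`. -/
def euler (Q : FinQuiver) {R : Type} [CommRing R] (α β : Q.V → R) : R :=
  (∑ v : Q.V, α v * β v) - ∑ a : (Σ x : Q.V, Σ y : Q.V, x ⟶ y), α a.1 * β a.2.1

/-- The symmetrized Euler form of the quiver `Q`. -/
def symEuler (Q : FinQuiver) {R : Type} [CommRing R] (α β : Q.V → R) : R :=
  euler Q α β + euler Q β α

/-- The reflection in the vector `v`: `s_v(w) = w - (v, w)·v`. -/
def reflV (Q : FinQuiver) (v : Q.V → ℤ) : (Q.V → ℤ) → (Q.V → ℤ) :=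
  fun w => w - symEuler Q v w • v

/-- The composition (product, written from left to right) of a finite sequence of
linear transformations. -/
def comps (Q : FinQuiver) {m : ℕ} (g : Fin m → ((Q.V → ℤ) → (Q.V → ℤ))) :
    (Q.V → ℤ) → (Q.V → ℤ) :=
  (List.ofFn g).foldr (· ∘ ·) id

open scoped Classical in
/-- The simple root at a vertex. -/
def simRoot (Q : FinQuiver) (v : Q.V) : Q.V → ℤ := fun w => if w = v then 1 else 0

/-- The simple reflection at a vertex. -/
def sref (Q : FinQuiver) (v : Q.V) : (Q.V → ℤ) → (Q.V → ℤ) := reflV Q (simRoot Q v)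

/-- An enumeration of the vertices is compatible with the arrows of `Q` if sources
of arrows come before targets. -/
def OrdCompatible (Q : FinQuiver) (ord : Fin (Fintype.card Q.V) ≃ Q.V) : Prop :=
  ∀ (x y : Q.V), (x ⟶ y) → ord.symm x < ord.symm y

/-- The Coxeter element `cox(Q)`: the product of the simple reflections from left to
right in an order compatible with the arrows of `Q`. -/
def coxeter (Q : FinQuiver) (ord : Fin (Fintype.card Q.V) ≃ Q.V) :
    (Q.V → ℤ) → (Q.V → ℤ) :=
  comps Q fun i => sref Q (ord i)

/-- The product of the simple reflections indexed by a word (a list of vertices). -/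
def wordProd (Q : FinQuiver) (l : List Q.V) : (Q.V → ℤ) → (Q.V → ℤ) :=
  (l.map (sref Q)).foldr (· ∘ ·) id

/-- Membership in the Coxeter group `W` (realized faithfully on the root lattice). -/
def InW (Q : FinQuiver) (w : (Q.V → ℤ) → (Q.V → ℤ)) : Prop :=
  ∃ l : List Q.V, w = wordProd Q l

/-- The reflections of `W`: the conjugates of the simple reflections. -/
def IsRefl (Q : FinQuiver) (t : (Q.V → ℤ) → (Q.V → ℤ)) : Prop :=
  ∃ (l : List Q.V) (i : Q.V), t = wordProd Q l ∘ sref Q i ∘ wordProd Q l.reverse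

/-- The absolute length: the least length of an expression as a product of reflections. -/
def ellT (Q : FinQuiver) (w : (Q.V → ℤ) → (Q.V → ℤ)) : ℕ :=
  sInf { m | ∃ f : Fin m → ((Q.V → ℤ) → (Q.V → ℤ)), (∀ i, IsRefl Q (f i)) ∧ w = comps Q f }

/-- The absolute order on `W`. -/
def absLe (Q : FinQuiver) : ((Q.V → ℤ) → (Q.V → ℤ)) → ((Q.V → ℤ) → (Q.V → ℤ)) → Prop :=
  Relation.ReflTransGen fun u v => ∃ t, IsRefl Q t ∧ v = u ∘ t ∧ ellT Q v = ellT Q u + 1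

/-- The noncrossing partitions `NC_Q`: the interval `[e, cox(Q)]` in absolute order. -/
def NCSet (Q : FinQuiver) (ord : Fin (Fintype.card Q.V) ≃ Q.V) :
    Set ((Q.V → ℤ) → (Q.V → ℤ)) :=
  { w | InW Q w ∧ absLe Q w (coxeter Q ord) }

/-- `Q` is of finite (Dynkin) type: the symmetrized Euler form is positive definite. -/
def FiniteType (Q : FinQuiver) : Prop :=
  ∀ α : Q.V → ℚ, α ≠ 0 → 0 < symEuler Q α α

/-- `Q` is of affine (extended Dynkin) type: the symmetrized Euler form is positive
semidefinite with nontrivial radical. -/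
def AffineType (Q : FinQuiver) : Prop :=
  (∀ α : Q.V → ℚ, 0 ≤ symEuler Q α α) ∧ ∃ α : Q.V → ℚ, α ≠ 0 ∧ symEuler Q α α = 0

end Comb

section Statement13

variable {k : Type} [Field k] {Q : FinQuiver}

/-- The subcategory of representations that are semistable with respect to the
stability condition `θ : K₀(kQ) → ℤ`: those `M` with `θ(dim M) = 0` and
`θ(dim W) ≤ 0` for every subrepresentation `W ⊆ M`. -/
def SemistableSet (θ : (Q.V → ℤ) → ℤ) : Set (RepC k Q) :=
  { M | FinDim M ∧ θ (dimVec M) = 0 ∧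
      ∀ (N : RepC k Q) (i : N ⟶ M), Mono i → θ (dimVec N) ≤ 0 }

abbrev vx (M : RepC k Q) (v : Q.V) : ModuleCat.{0} k := M.obj ((Paths.of Q.V).obj v)

def ap {M N : RepC k Q} (f : M ⟶ N) (v : Q.V) : vx M v →ₗ[k] vx N v := (f.app _).hom

def ar (M : RepC k Q) {x y : Q.V} (a : x ⟶ y) : vx M x →ₗ[k] vx M y :=
  (M.map ((Paths.of Q.V).map a)).hom

lemma ap_comp {M N L : RepC k Q} (f : M ⟶ N) (g : N ⟶ L) (v : Q.V) (x : vx M v) :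
    ap (f ≫ g) v x = ap g v (ap f v x) := rfl

lemma ap_id (M : RepC k Q) (v : Q.V) (x : vx M v) : ap (𝟙 M) v x = x := rfl

lemma ap_zero {M N : RepC k Q} (v : Q.V) (x : vx M v) : ap (0 : M ⟶ N) v x = 0 := rfl

lemma ap_add {M N : RepC k Q} (f g : M ⟶ N) (v : Q.V) (x : vx M v) :
    ap (f + g) v x = ap f v x + ap g v x := rfl

lemma ap_sub {M N : RepC k Q} (f g : M ⟶ N) (v : Q.V) (x : vx M v) :
    ap (f - g) v x = ap f v x - ap g v x := rfl

lemma ap_nat {M N : RepC k Q} (f : M ⟶ N) {x y : Q.V} (a : x ⟶ y) (m : vx M x) :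
    ap f y (ar M a m) = ar N a (ap f x m) := by
  have h := f.naturality ((Paths.of Q.V).map a)
  exact congrArg (fun t : vx M x ⟶ vx N y => t.hom m) h

lemma rhom_ext {M N : RepC k Q} {f g : M ⟶ N} (h : ∀ v x, ap f v x = ap g v x) : f = g := by
  ext v : 2
  exact ModuleCat.hom_ext (LinearMap.ext (h v))

lemma mono_iff_ap {M N : RepC k Q} (f : M ⟶ N) :
    Mono f ↔ ∀ v, Function.Injective (ap f v) := by
  rw [NatTrans.mono_iff_mono_app]
  constructor
  · intro h v
    exact (ModuleCat.mono_iff_injective _).1 (h v)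
  · intro h v
    exact (ModuleCat.mono_iff_injective _).2 (h v)

lemma epi_iff_ap {M N : RepC k Q} (f : M ⟶ N) :
    Epi f ↔ ∀ v, Function.Surjective (ap f v) := by
  rw [NatTrans.epi_iff_epi_app]
  constructor
  · intro h v
    exact (ModuleCat.epi_iff_surjective _).1 (h v)
  · intro h v
    exact (ModuleCat.epi_iff_surjective _).2 (h v)

/-- action of a path -/
def pm (M : RepC k Q) {x y : Q.V} (p : Quiver.Path x y) : vx M x →ₗ[k] vx M y :=
  (M.map (X := (Paths.of Q.V).obj x) (Y := (Paths.of Q.V).obj y) p).hom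

lemma pm_nil (M : RepC k Q) (x : Q.V) (m : vx M x) :
    pm M (Quiver.Path.nil : Quiver.Path x x) m = m := by
  have h := M.map_id ((Paths.of Q.V).obj x)
  exact congrArg (fun t : vx M x ⟶ vx M x => t.hom m) h

lemma pm_cons (M : RepC k Q) {x y z : Q.V} (p : Quiver.Path x y) (a : y ⟶ z) (m : vx M x) :
    pm M (p.cons a) m = ar M a (pm M p m) := by
  have h := M.map_comp (X := (Paths.of Q.V).obj x) (Y := (Paths.of Q.V).obj y)
    (Z := (Paths.of Q.V).obj z) p ((Paths.of Q.V).map a)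
  exact congrArg (fun t : vx M x ⟶ vx M z => t.hom m) h

lemma pm_nat {M N : RepC k Q} (φ : ∀ v, vx M v →ₗ[k] vx N v)
    (h : ∀ {x y : Q.V} (a : x ⟶ y) (m : vx M x), φ y (ar M a m) = ar N a (φ x m))
    {x y : Q.V} (p : Quiver.Path x y) (m : vx M x) : φ y (pm M p m) = pm N p (φ x m) := by
  induction p with
  | nil => rw [pm_nil, pm_nil]
  | cons p a ih => rw [pm_cons, pm_cons, h, ih]

def mkHom {M N : RepC k Q} (φ : ∀ v, vx M v →ₗ[k] vx N v)
    (h : ∀ {x y : Q.V} (a : x ⟶ y) (m : vx M x), φ y (ar M a m) = ar N a (φ x m)) : M ⟶ N where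
  app v := ModuleCat.ofHom (φ v)
  naturality := by
    intro x y p
    refine ModuleCat.hom_ext (LinearMap.ext fun m => ?_)
    exact pm_nat φ h (x := x) (y := y) p m

lemma ap_mkHom {M N : RepC k Q} (φ : ∀ v, vx M v →ₗ[k] vx N v)
    (h : ∀ {x y : Q.V} (a : x ⟶ y) (m : vx M x), φ y (ar M a m) = ar N a (φ x m)) (v : Q.V)
    (x : vx M v) : ap (mkHom φ h) v x = φ v x := rfl

def mkRep (X : Q.V → ModuleCat.{0} k)
    (A : ∀ {x y : Q.V} (_ : x ⟶ y), X x →ₗ[k] X y) : RepC k Q :=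
  Paths.lift { obj := X, map := fun a => ModuleCat.ofHom (A a) }

lemma vx_mkRep (X : Q.V → ModuleCat.{0} k)
    (A : ∀ {x y : Q.V} (_ : x ⟶ y), X x →ₗ[k] X y) (v : Q.V) : vx (mkRep X A) v = X v := rfl

lemma ar_mkRep (X : Q.V → ModuleCat.{0} k)
    (A : ∀ {x y : Q.V} (_ : x ⟶ y), X x →ₗ[k] X y) {x y : Q.V} (a : x ⟶ y) (m : X x) :
    ar (mkRep X A) a m = A a m := rfl

lemma isZero_iff (M : RepC k Q) : IsZero M ↔ ∀ v, Subsingleton (vx M v) := by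
  rw [Functor.isZero_iff]
  constructor
  · intro h v
    exact (ModuleCat.isZero_iff_subsingleton).1 (h _)
  · intro h v
    exact (ModuleCat.isZero_iff_subsingleton).2 (h _)

lemma ap_eq_zero_of_exact {S : ShortComplex (RepC k Q)} (hS : S.Exact) (v : Q.V) (x : vx S.X₂ v)
    (hx : ap S.g v x = 0) : ∃ y, ap S.f v y = x := by
  have h := hS.map ((evaluation (Paths Q.V) (ModuleCat.{0} k)).obj ((Paths.of Q.V).obj v))
  rw [ShortComplex.moduleCat_exact_iff] at h
  exact h x hx

lemma kernel_lift_elt {M N : RepC k Q} (f : M ⟶ N) (v : Q.V) (x : vx M v) (hx : ap f v x = 0) :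
    ∃ y, ap (kernel.ι f) v y = x :=
  ap_eq_zero_of_exact (ShortComplex.exact_of_f_is_kernel
    (ShortComplex.mk (kernel.ι f) f (kernel.condition f)) (kernelIsKernel f)) v x hx

lemma kernel_ι_inj {M N : RepC k Q} (f : M ⟶ N) (v : Q.V) :
    Function.Injective (ap (kernel.ι f) v) := (mono_iff_ap _).1 inferInstance v

lemma ap_kernel_cond {M N : RepC k Q} (f : M ⟶ N) (v : Q.V) (y : vx (kernel f) v) :
    ap f v (ap (kernel.ι f) v y) = 0 := by
  rw [← ap_comp, kernel.condition, ap_zero]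

lemma coker_elt {M N : RepC k Q} (f : M ⟶ N) (v : Q.V) (x : vx N v)
    (hx : ap (cokernel.π f) v x = 0) : ∃ y, ap f v y = x :=
  ap_eq_zero_of_exact (ShortComplex.exact_of_g_is_cokernel
    (ShortComplex.mk f (cokernel.π f) (cokernel.condition f)) (cokernelIsCokernel f)) v x hx

lemma ap_coker_cond {M N : RepC k Q} (f : M ⟶ N) (v : Q.V) (y : vx M v) :
    ap (cokernel.π f) v (ap f v y) = 0 := by
  rw [← ap_comp, cokernel.condition, ap_zero]

lemma shortExact_of {N E M : RepC k Q} (i : N ⟶ E) (p : E ⟶ M) (w : i ≫ p = 0)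
    (hi : ∀ v, Function.Injective (ap i v)) (hp : ∀ v, Function.Surjective (ap p v))
    (he : ∀ v x, ap p v x = 0 → ∃ y, ap i v y = x) : (ShortComplex.mk i p w).ShortExact := by
  have hm : Mono i := (mono_iff_ap i).2 hi
  have hep : Epi p := (epi_iff_ap p).2 hp
  refine { exact := ?_, mono_f := hm, epi_g := hep }
  rw [ShortComplex.exact_iff_epi_kernel_lift, epi_iff_ap]
  intro v z
  obtain ⟨y, hy⟩ := he v (ap (kernel.ι p) v z) (ap_kernel_cond _ _ _)
  refine ⟨y, kernel_ι_inj p v ?_⟩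
  rw [← hy, ← ap_comp]
  change ap (kernel.lift p i w ≫ kernel.ι p) v y = _
  rw [kernel.lift_ι]

lemma ses_kernel {C : Type*} [Category C] [Abelian C] {M N : C} (p : M ⟶ N) [Epi p] :
    (ShortComplex.mk (kernel.ι p) p (kernel.condition p)).ShortExact :=
  { exact := ShortComplex.exact_of_f_is_kernel _ (kernelIsKernel p),
    mono_f := by dsimp; infer_instance, epi_g := by dsimp; infer_instance }

lemma ses_coker {C : Type*} [Category C] [Abelian C] {M N : C} (i : M ⟶ N) [Mono i] :
    (ShortComplex.mk i (cokernel.π i) (cokernel.condition i)).ShortExact :=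
  { exact := ShortComplex.exact_of_g_is_cokernel _ (cokernelIsCokernel i),
    mono_f := by dsimp; infer_instance, epi_g := by dsimp; infer_instance }


section ExtAbs
variable {C : Type*} [Category C] [Abelian C]

lemma ext1Zero_of_section {A B : C}
    (h : ∀ (E : C) (i : B ⟶ E) (p : E ⟶ A) (w : i ≫ p = 0),
      (ShortComplex.mk i p w).ShortExact → ∃ s : A ⟶ E, s ≫ p = 𝟙 A) : Ext1Zero A B := by
  intro E i p w hS
  obtain ⟨s, hs⟩ := h E i p w hS
  let sp := ShortComplex.Splitting.ofExactOfSection _ hS.exact s hs hS.mono_f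
  exact ⟨sp.r, sp.f_r⟩

lemma Ext1Zero.section' {A B : C} (h : Ext1Zero A B) {E : C} {i : B ⟶ E} {p : E ⟶ A}
    (w : i ≫ p = 0) (hS : (ShortComplex.mk i p w).ShortExact) : ∃ s : A ⟶ E, s ≫ p = 𝟙 A := by
  obtain ⟨r, hr⟩ := h E i p w hS
  let sp := ShortComplex.Splitting.ofExactOfRetraction _ hS.exact r hr hS.epi_g
  exact ⟨sp.s, sp.s_g⟩

/-- lifting through an epi -/
lemma Ext1Zero.lift {A E D : C} (p : E ⟶ D) [Epi p] (h : Ext1Zero A (kernel p)) (f : A ⟶ D) :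
    ∃ g : A ⟶ E, g ≫ p = f := by
  have w0 : kernel.ι p ≫ p = (0 : kernel p ⟶ A) ≫ f := by rw [kernel.condition, zero_comp]
  have w : pullback.lift (kernel.ι p) (0 : kernel p ⟶ A) w0 ≫ pullback.snd p f = 0 :=
    pullback.lift_snd _ _ _
  have hS : (ShortComplex.mk (pullback.lift (kernel.ι p) (0 : kernel p ⟶ A) w0)
      (pullback.snd p f) w).ShortExact := by
    have hm : Mono (pullback.lift (kernel.ι p) (0 : kernel p ⟶ A) w0) := by
      have : Mono (pullback.lift (kernel.ι p) (0 : kernel p ⟶ A) w0 ≫ pullback.fst p f) := by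
        rw [pullback.lift_fst]; infer_instance
      exact mono_of_mono _ (pullback.fst p f)
    refine { exact := ?_, mono_f := hm, epi_g := by dsimp; infer_instance }
    apply ShortComplex.exact_of_f_is_kernel
    refine KernelFork.IsLimit.ofι _ _ (fun {W} g hg => kernel.lift p (g ≫ pullback.fst p f) ?_) ?_ ?_
    · rw [Category.assoc, pullback.condition, reassoc_of% hg, zero_comp]
    · intro W g hg
      apply pullback.hom_ext
      · rw [Category.assoc, pullback.lift_fst, kernel.lift_ι]
      · rw [Category.assoc, pullback.lift_snd, comp_zero]
        exact hg.symm
    · intro W g hg m hm'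
      rw [← cancel_mono (kernel.ι p), kernel.lift_ι, ← hm', Category.assoc, pullback.lift_fst]
  obtain ⟨s, hs⟩ := h.section' w hS
  exact ⟨s ≫ pullback.fst p f, by rw [Category.assoc, pullback.condition, reassoc_of% hs]⟩

/-- extension along a mono -/
lemma Ext1Zero.extend {A E N : C} (i : A ⟶ E) [Mono i] (h : Ext1Zero (cokernel i) N) (f : A ⟶ N) :
    ∃ g : E ⟶ N, i ≫ g = f := by
  have w0 : i ≫ cokernel.π i = f ≫ (0 : N ⟶ cokernel i) := by rw [cokernel.condition, comp_zero]
  have w : pushout.inr i f ≫ pushout.desc (cokernel.π i) (0 : N ⟶ cokernel i) w0 = 0 :=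
    pushout.inr_desc _ _ _
  have hS : (ShortComplex.mk (pushout.inr i f)
      (pushout.desc (cokernel.π i) (0 : N ⟶ cokernel i) w0) w).ShortExact := by
    have hm : Epi (pushout.desc (cokernel.π i) (0 : N ⟶ cokernel i) w0) := by
      have : Epi (pushout.inl i f ≫ pushout.desc (cokernel.π i) (0 : N ⟶ cokernel i) w0) := by
        rw [pushout.inl_desc]; infer_instance
      exact epi_of_epi (pushout.inl i f) _
    refine { exact := ?_, epi_g := hm, mono_f := by dsimp; infer_instance }
    apply ShortComplex.exact_of_g_is_cokernel
    refine CokernelCofork.IsColimit.ofπ _ _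
      (fun {W} g hg => cokernel.desc i (pushout.inl i f ≫ g) ?_) ?_ ?_
    · rw [← Category.assoc, pushout.condition, Category.assoc, hg, comp_zero]
    · intro W g hg
      apply pushout.hom_ext
      · rw [← Category.assoc, pushout.inl_desc, cokernel.π_desc]
      · rw [← Category.assoc, pushout.inr_desc, zero_comp]
        exact hg.symm
    · intro W g hg m hm'
      rw [← cancel_epi (cokernel.π i), cokernel.π_desc, ← hm', ← Category.assoc, pushout.inl_desc]
  obtain ⟨s, hs⟩ := h _ _ _ w hS
  exact ⟨pushout.inl i f ≫ s, by rw [← Category.assoc, pushout.condition, Category.assoc, hs, Category.comp_id]⟩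

lemma Ext1Zero.of_iso_right {A B B' : C} (h : Ext1Zero A B) (e : B' ≅ B) : Ext1Zero A B' := by
  intro E' i' p' w' hS'
  obtain ⟨r, hr⟩ := h E' (e.inv ≫ i') p' (by rw [Category.assoc, w', comp_zero]) (by
      refine ShortComplex.shortExact_of_iso ?_ hS'
      exact ShortComplex.isoMk e (Iso.refl _) (Iso.refl _) (by simp) (by simp))
  refine ⟨r ≫ e.inv, ?_⟩
  rw [← cancel_epi e.inv]
  rw [Category.assoc] at hr
  rw [reassoc_of% hr, Category.comp_id]

lemma Ext1Zero.biproduct_left {ι : Type} [Finite ι] (f : ι → C) {N : C} (h : ∀ i, Ext1Zero (f i) N) :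
    Ext1Zero (⨁ f) N := by
  apply ext1Zero_of_section
  intro E i p w hS
  have := hS.epi_g
  have := hS.mono_f
  dsimp at *
  have e : kernel p ≅ N := (kernelIsKernel p).conePointUniqueUpToIso hS.fIsKernel
  have key : ∀ j, ∃ g : f j ⟶ E, g ≫ p = biproduct.ι f j := fun j =>
    Ext1Zero.lift p ((h j).of_iso_right e) _
  choose g hg using key
  refine ⟨biproduct.desc g, ?_⟩
  apply biproduct.hom_ext'
  intro j
  rw [← Category.assoc, biproduct.ι_desc, hg, Category.comp_id]

lemma Ext1Zero.of_iso_left {A A' B : C} (h : Ext1Zero A B) (e : A' ≅ A) : Ext1Zero A' B := by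
  intro E' i' p' w' hS'
  obtain ⟨r, hr⟩ := h E' i' (p' ≫ e.hom) (by rw [← Category.assoc, w', zero_comp]) (by
      refine ShortComplex.shortExact_of_iso ?_ hS'
      exact ShortComplex.isoMk (Iso.refl _) (Iso.refl _) e (by simp) (by simp))
  exact ⟨r, hr⟩

lemma Ext1Zero.biproduct_right {ι : Type} [Finite ι] (f : ι → C) {A : C} (h : ∀ i, Ext1Zero A (f i)) :
    Ext1Zero A (⨁ f) := by
  intro E i p w hS
  have := hS.epi_g
  have := hS.mono_f
  dsimp at *
  have e : cokernel i ≅ A := (cokernelIsCokernel i).coconePointUniqueUpToIso hS.gIsCokernel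
  have key : ∀ j, ∃ g : E ⟶ f j, i ≫ g = biproduct.π f j := fun j =>
    Ext1Zero.extend i ((h j).of_iso_left e) _
  choose g hg using key
  refine ⟨biproduct.lift g, ?_⟩
  apply biproduct.hom_ext
  intro j
  rw [Category.assoc, biproduct.lift_π, hg, Category.id_comp]

end ExtAbs

section Cocycle

abbrev Arr (Q : FinQuiver) := Σ x : Q.V, Σ y : Q.V, x ⟶ y

/-- the standard two term complex computing Hom and Ext -/
def dMap (M N : RepC k Q) : (∀ v : Q.V, vx M v →ₗ[k] vx N v) →ₗ[k]
    (∀ a : Arr Q, vx M a.1 →ₗ[k] vx N a.2.1) where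
  toFun φ a := (ar N a.2.2).comp (φ a.1) - (φ a.2.1).comp (ar M a.2.2)
  map_add' φ ψ := by
    funext a; ext m; simp; abel
  map_smul' c φ := by
    funext a; ext m; simp [smul_sub]

lemma dMap_apply (M N : RepC k Q) (φ) {x y : Q.V} (a : x ⟶ y) (m : vx M x) :
    dMap M N φ ⟨x, y, a⟩ m = ar N a (φ x m) - φ y (ar M a m) := rfl

/-- extension with given cocycle -/
def extRep (M N : RepC k Q) (c : ∀ a : Arr Q, vx M a.1 →ₗ[k] vx N a.2.1) : RepC k Q :=
  mkRep (fun v => ModuleCat.of k (vx N v × vx M v)) (fun {x y} a =>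
    LinearMap.prod ((ar N a).comp (LinearMap.fst k _ _) +
      (c ⟨x, y, a⟩).comp (LinearMap.snd k _ _)) ((ar M a).comp (LinearMap.snd k _ _)))

lemma ar_extRep (M N : RepC k Q) (c : ∀ a : Arr Q, vx M a.1 →ₗ[k] vx N a.2.1) {x y : Q.V}
    (a : x ⟶ y) (n : vx N x) (m : vx M x) :
    ar (extRep M N c) a ((n, m) : vx N x × vx M x) =
      ((ar N a n + c ⟨x, y, a⟩ m, ar M a m) : vx N y × vx M y) := rfl

def extI (M N : RepC k Q) (c : ∀ a : Arr Q, vx M a.1 →ₗ[k] vx N a.2.1) : N ⟶ extRep M N c :=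
  mkHom (N := extRep M N c) (fun v => LinearMap.inl k (vx N v) (vx M v)) (by
    intro x y a m
    refine Eq.trans ?_ (ar_extRep M N c a m 0).symm
    rw [map_zero, map_zero, add_zero]
    rfl)

def extP (M N : RepC k Q) (c : ∀ a : Arr Q, vx M a.1 →ₗ[k] vx N a.2.1) : extRep M N c ⟶ M :=
  mkHom (M := extRep M N c) (fun v => LinearMap.snd k (vx N v) (vx M v)) (by
    intro x y a m
    rfl)

lemma ext_w (M N : RepC k Q) (c : ∀ a : Arr Q, vx M a.1 →ₗ[k] vx N a.2.1) :
    extI M N c ≫ extP M N c = 0 := by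
  apply rhom_ext
  intro v x
  rfl

lemma ext_ses (M N : RepC k Q) (c : ∀ a : Arr Q, vx M a.1 →ₗ[k] vx N a.2.1) :
    (ShortComplex.mk (extI M N c) (extP M N c) (ext_w M N c)).ShortExact := by
  apply shortExact_of
  · intro v x y h
    exact congrArg Prod.fst h
  · intro v x
    exact ⟨((0, x) : vx N v × vx M v), rfl⟩
  · intro v x h
    exact ⟨x.1, Prod.ext rfl h.symm⟩

lemma Ext1Zero.dMap_surj {M N : RepC k Q} (h : Ext1Zero M N) : Function.Surjective (dMap M N) := by
  intro c
  obtain ⟨r, hr⟩ := h _ _ _ (ext_w M N c) (ext_ses M N c)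
  refine ⟨fun v => (ap r v).comp (LinearMap.inr k (vx N v) (vx M v)), ?_⟩
  have hr' : ∀ v (n : vx N v), ap r v ((n, 0) : vx N v × vx M v) = n := by
    intro v n
    exact (ap_comp (extI M N c) r v n).symm.trans (by rw [hr, ap_id])
  funext ⟨x, y, a⟩
  ext m
  rw [dMap_apply]
  have h1 := ap_nat r a ((0, m) : vx N x × vx M x)
  have h2 : ar (extRep M N c) a ((0, m) : vx N x × vx M x) =
    ((c ⟨x, y, a⟩ m, 0) : vx N y × vx M y) + ((0, ar M a m) : vx N y × vx M y) := by
    refine (ar_extRep M N c a 0 m).trans ?_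
    rw [map_zero, zero_add]
    exact Prod.ext (add_zero _).symm (zero_add _).symm
  have h3 : ap r y (ar (extRep M N c) a ((0, m) : vx N x × vx M x)) =
    ap r y ((c ⟨x, y, a⟩ m, 0) : vx N y × vx M y) + ap r y ((0, ar M a m) : vx N y × vx M y) := by
    rw [h2]; exact map_add (ap r y) _ _
  rw [hr'] at h3
  change ar N a (ap r x ((0, m) : vx N x × vx M x)) - ap r y ((0, ar M a m) : vx N y × vx M y) = _
  rw [← h1, h3]
  abel

/-- a short exact sequence has a cocycle -/
lemma exists_cocycle {N E M : RepC k Q} (i : N ⟶ E) (p : E ⟶ M) (w : i ≫ p = 0)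
    (hS : (ShortComplex.mk i p w).ShortExact) :
    ∃ (s : ∀ v, vx M v →ₗ[k] vx E v) (c : ∀ a : Arr Q, vx M a.1 →ₗ[k] vx N a.2.1),
      (∀ v m, ap p v (s v m) = m) ∧
      ∀ {x y : Q.V} (a : x ⟶ y) m, ap i y (c ⟨x, y, a⟩ m) = ar E a (s x m) - s y (ar M a m) := by
  have hmi := (mono_iff_ap i).1 hS.mono_f
  have hep := (epi_iff_ap p).1 hS.epi_g
  have h1 : ∀ v, ∃ s : vx M v →ₗ[k] vx E v, (ap p v).comp s = LinearMap.id := fun v =>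
    LinearMap.exists_rightInverse_of_surjective _ (LinearMap.range_eq_top.2 (hep v))
  have h2 : ∀ v, ∃ r : vx E v →ₗ[k] vx N v, r.comp (ap i v) = LinearMap.id := fun v =>
    LinearMap.exists_leftInverse_of_injective _ (LinearMap.ker_eq_bot.2 (hmi v))
  choose s hs using h1
  choose r hr using h2
  have hs' : ∀ v m, ap p v (s v m) = m := fun v m => LinearMap.congr_fun (hs v) m
  have hr' : ∀ v m, r v (ap i v m) = m := fun v m => LinearMap.congr_fun (hr v) m
  refine ⟨s, fun a => (r a.2.1).comp ((ar E a.2.2).comp (s a.1) - (s a.2.1).comp (ar M a.2.2)), hs', ?_⟩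
  intro x y a m
  have h0 : ap p y (ar E a (s x m) - s y (ar M a m)) = 0 := by
    rw [map_sub, ap_nat, hs', hs', sub_self]
  obtain ⟨n, hn⟩ := ap_eq_zero_of_exact hS.exact y _ h0
  change ap i y (r y (ar E a (s x m) - s y (ar M a m))) = _
  rw [← hn]
  change ap i y (r y (ap i y n)) = ap i y n
  rw [hr']

lemma ext1Zero_of_surj {M N : RepC k Q} (h : Function.Surjective (dMap M N)) : Ext1Zero M N := by
  apply ext1Zero_of_section
  intro E i p w hS
  obtain ⟨s, c, hs, hc⟩ := exists_cocycle i p w hS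
  obtain ⟨φ, hφ⟩ := h c
  have hip : ∀ v n, ap p v (ap i v n) = 0 := fun v n => by rw [← ap_comp, w, ap_zero]
  refine ⟨mkHom (fun v => s v - (ap i v).comp (φ v)) ?_, ?_⟩
  · intro x y a m
    have h1 := hc a m
    rw [← hφ, dMap_apply, map_sub, ap_nat] at h1
    simp only [LinearMap.sub_apply, LinearMap.comp_apply, map_sub]
    rw [sub_eq_sub_iff_add_eq_add] at h1 ⊢
    rw [add_comm, ← h1, add_comm]
  · apply rhom_ext
    intro v m
    rw [ap_comp, ap_mkHom]
    simp [hs, hip, ap_id]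

lemma ext1Zero_iff {M N : RepC k Q} : Ext1Zero M N ↔ Function.Surjective (dMap M N) :=
  ⟨fun h => h.dMap_surj, ext1Zero_of_surj⟩

lemma Ext1Zero.of_epi {M N N' : RepC k Q} (h : Ext1Zero M N) (f : N ⟶ N') [hf : Epi f] :
    Ext1Zero M N' := by
  rw [ext1Zero_iff] at *
  rw [epi_iff_ap] at hf
  intro c
  have h1 : ∀ v, ∃ s : vx N' v →ₗ[k] vx N v, (ap f v).comp s = LinearMap.id := fun v =>
    LinearMap.exists_rightInverse_of_surjective _ (LinearMap.range_eq_top.2 (hf v))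
  choose s hs using h1
  have hs' : ∀ v m, ap f v (s v m) = m := fun v m => LinearMap.congr_fun (hs v) m
  obtain ⟨φ, hφ⟩ := h (fun a => (s a.2.1).comp (c a))
  refine ⟨fun v => (ap f v).comp (φ v), ?_⟩
  funext ⟨x, y, a⟩
  ext m
  have := congrArg (ap f y) (LinearMap.congr_fun (congrFun hφ ⟨x, y, a⟩) m)
  rw [dMap_apply, map_sub, ap_nat] at this
  rw [dMap_apply]
  exact this.trans (hs' _ _)

lemma Ext1Zero.of_mono {M M' N : RepC k Q} (h : Ext1Zero M N) (f : M' ⟶ M) [hf : Mono f] :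
    Ext1Zero M' N := by
  rw [ext1Zero_iff] at *
  rw [mono_iff_ap] at hf
  intro c
  have h1 : ∀ v, ∃ s : vx M v →ₗ[k] vx M' v, s.comp (ap f v) = LinearMap.id := fun v =>
    LinearMap.exists_leftInverse_of_injective _ (LinearMap.ker_eq_bot.2 (hf v))
  choose s hs using h1
  have hs' : ∀ v m, s v (ap f v m) = m := fun v m => LinearMap.congr_fun (hs v) m
  obtain ⟨φ, hφ⟩ := h (fun a => (c a).comp (s a.1))
  refine ⟨fun v => (φ v).comp (ap f v), ?_⟩
  funext ⟨x, y, a⟩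
  ext m
  have := (LinearMap.congr_fun (congrFun hφ ⟨x, y, a⟩) (ap f x m))
  rw [dMap_apply, ← ap_nat] at this
  rw [dMap_apply]
  refine this.trans ?_
  change c ⟨x, y, a⟩ (s x (ap f x m)) = _
  rw [hs']

/-- lifting an extension along an epimorphism (heredity) -/
lemma exists_ext_lift {X E A A0 : RepC k Q} (i : X ⟶ E) (p : E ⟶ A) (w : i ≫ p = 0)
    (hS : (ShortComplex.mk i p w).ShortExact) (e : A0 ⟶ X) [he : Epi e] :
    ∃ (E' : RepC k Q) (i' : A0 ⟶ E') (p' : E' ⟶ A) (w' : i' ≫ p' = 0) (q : E' ⟶ E),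
      (ShortComplex.mk i' p' w').ShortExact ∧ Epi q := by
  obtain ⟨s, c, hs, hc⟩ := exists_cocycle i p w hS
  rw [epi_iff_ap] at he
  have h1 : ∀ v, ∃ t : vx X v →ₗ[k] vx A0 v, (ap e v).comp t = LinearMap.id := fun v =>
    LinearMap.exists_rightInverse_of_surjective _ (LinearMap.range_eq_top.2 (he v))
  choose t ht using h1
  have ht' : ∀ v m, ap e v (t v m) = m := fun v m => LinearMap.congr_fun (ht v) m
  let c' : ∀ a : Arr Q, vx A a.1 →ₗ[k] vx A0 a.2.1 := fun a => (t a.2.1).comp (c a)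
  refine ⟨extRep A A0 c', extI A A0 c', extP A A0 c', ext_w _ _ _,
    mkHom (M := extRep A A0 c') (fun v =>
      LinearMap.coprod ((ap i v).comp (ap e v)) (s v)) ?_, ext_ses _ _ _, ?_⟩
  · rintro x y a ⟨(m : vx A0 x), (n : vx A x)⟩
    have hc := hc a n
    change ap i y (ap e y (ar A0 a m + t y (c ⟨x, y, a⟩ n))) + s y (ar A a n) =
      ar E a (ap i x (ap e x m) + s x n)
    rw [map_add, map_add, ht', hc, map_add, ← ap_nat, ← ap_nat]
    abel
  · rw [epi_iff_ap]
    intro v z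
    have h0 : ap p v (z - s v (ap p v z)) = 0 := by rw [map_sub, hs, sub_self]
    obtain ⟨n, hn⟩ := ap_eq_zero_of_exact hS.exact v _ h0
    obtain ⟨m, hm⟩ := he v n
    refine ⟨((m, ap p v z) : vx A0 v × vx A v), ?_⟩
    change ap i v (ap e v m) + s v (ap p v z) = z
    rw [hm]
    change ap i v n = _ at hn
    rw [hn]
    abel

lemma homZero_iff {M N : RepC k Q} : HomZero M N ↔ Function.Injective (dMap M N) := by
  rw [injective_iff_map_eq_zero]
  constructor
  · intro h φ hφ
    have := h (mkHom φ (by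
      intro x y a m
      have := LinearMap.congr_fun (congrFun hφ ⟨x, y, a⟩) m
      rw [dMap_apply] at this
      exact (sub_eq_zero.1 this).symm))
    funext v
    ext m
    exact congrArg (fun f => ap f v m) this
  · intro h f
    have := h (fun v => ap f v) (by
      funext ⟨x, y, a⟩
      ext m
      rw [dMap_apply, ap_nat, sub_self]; rfl)
    apply rhom_ext
    intro v m
    exact LinearMap.congr_fun (congrFun this v) m

lemma euler_eq {M N : RepC k Q} (hM : FinDim M) (hN : FinDim N) :
    euler Q (dimVec M) (dimVec N) =
      (Module.finrank k (∀ v : Q.V, vx M v →ₗ[k] vx N v) : ℤ) -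
      (Module.finrank k (∀ a : Arr Q, vx M a.1 →ₗ[k] vx N a.2.1) : ℤ) := by
  have := hM
  have := hN
  unfold FinDim at *
  rw [Module.finrank_pi_fintype, Module.finrank_pi_fintype]
  simp only [Module.finrank_linearMap]
  simp [euler, dimVec]

variable {M N : RepC k Q} (hM : FinDim M) (hN : FinDim N)
include hM hN

lemma euler_nonneg (h : Ext1Zero M N) : 0 ≤ euler Q (dimVec M) (dimVec N) := by
  rw [euler_eq hM hN]
  have := hM
  have := hN
  unfold FinDim at *
  have h1 := LinearMap.finrank_le_finrank_of_surjective (f := dMap M N) h.dMap_surj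
  lia

lemma euler_nonpos (h : HomZero M N) : euler Q (dimVec M) (dimVec N) ≤ 0 := by
  rw [euler_eq hM hN]
  have := hM
  have := hN
  unfold FinDim at *
  have h1 := LinearMap.finrank_le_finrank_of_injective (f := dMap M N) (homZero_iff.1 h)
  lia

lemma ext1Zero_of_euler (h : HomZero M N) (h0 : euler Q (dimVec M) (dimVec N) = 0) :
    Ext1Zero M N := by
  rw [euler_eq hM hN] at h0
  have := hM
  have := hN
  unfold FinDim at *
  rw [ext1Zero_iff]
  exact (LinearMap.injective_iff_surjective_of_finrank_eq_finrank (by lia)).1 (homZero_iff.1 h)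

end Cocycle


section AbC
variable {C : Type*} [Category C] [Abelian C]

lemma pullback_ses {A E D : C} (p : E ⟶ D) [Epi p] (f : A ⟶ D) :
    ∃ w, (ShortComplex.mk (pullback.lift (kernel.ι p) (0 : kernel p ⟶ A)
      (by rw [kernel.condition, zero_comp])) (pullback.snd p f) w).ShortExact := by
  have w0 : kernel.ι p ≫ p = (0 : kernel p ⟶ A) ≫ f := by rw [kernel.condition, zero_comp]
  have w : pullback.lift (kernel.ι p) (0 : kernel p ⟶ A) w0 ≫ pullback.snd p f = 0 :=
    pullback.lift_snd _ _ _
  refine ⟨w, ?_⟩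
  have hm : Mono (pullback.lift (kernel.ι p) (0 : kernel p ⟶ A) w0) := by
    have : Mono (pullback.lift (kernel.ι p) (0 : kernel p ⟶ A) w0 ≫ pullback.fst p f) := by
      rw [pullback.lift_fst]; infer_instance
    exact mono_of_mono _ (pullback.fst p f)
  refine { exact := ?_, mono_f := hm, epi_g := by dsimp; infer_instance }
  apply ShortComplex.exact_of_f_is_kernel
  refine KernelFork.IsLimit.ofι _ _ (fun {W} g hg => kernel.lift p (g ≫ pullback.fst p f) ?_) ?_ ?_
  · rw [Category.assoc, pullback.condition, reassoc_of% hg, zero_comp]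
  · intro W g hg
    apply pullback.hom_ext
    · rw [Category.assoc, pullback.lift_fst, kernel.lift_ι]
    · rw [Category.assoc, pullback.lift_snd, comp_zero]
      exact hg.symm
  · intro W g hg m hm'
    rw [← cancel_mono (kernel.ι p), kernel.lift_ι, ← hm', Category.assoc, pullback.lift_fst]

lemma IsTorsionClass.iso_mem {T : Set C} (h : IsTorsionClass T) {X Y : C} (hX : X ∈ T) (e : X ≅ Y) :
    Y ∈ T := h.quot_mem X hX Y e.hom inferInstance

lemma IsTorsionClass.isZero_mem {T : Set C} (h : IsTorsionClass T) {X : C} (hX : IsZero X) :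
    X ∈ T := h.iso_mem h.zero_mem hX.isoZero.symm

lemma IsTorsionClass.ses_mem {T : Set C} (h : IsTorsionClass T) {X Y Z : C} {i : X ⟶ Y} {p : Y ⟶ Z}
    {w : i ≫ p = 0} (hS : (ShortComplex.mk i p w).ShortExact) (hX : X ∈ T) (hZ : Z ∈ T) : Y ∈ T :=
  h.ext_mem _ hS hX hZ

lemma IsTorsionClass.pullback_mem {T : Set C} (h : IsTorsionClass T) {A E D : C} (p : E ⟶ D) [Epi p]
    (f : A ⟶ D) (hk : kernel p ∈ T) (hA : A ∈ T) : pullback p f ∈ T := by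
  obtain ⟨w, hS⟩ := pullback_ses p f
  exact h.ses_mem hS hk hA

end AbC

lemma FinDim.of_mono {M N : RepC k Q} (hN : FinDim N) (f : M ⟶ N) [hf : Mono f] : FinDim M := by
  intro v
  have := hN v
  exact FiniteDimensional.of_injective (ap f v) ((mono_iff_ap f).1 hf v)

lemma FinDim.of_epi {M N : RepC k Q} (hM : FinDim M) (f : M ⟶ N) [hf : Epi f] : FinDim N := by
  intro v
  have := hM v
  exact Module.Finite.of_surjective (ap f v) ((epi_iff_ap f).1 hf v)

lemma ap_sum {M N : RepC k Q} {ι : Type} (s : Finset ι) (f : ι → (M ⟶ N)) (v : Q.V) (x : vx M v) :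
    ap (∑ i ∈ s, f i) v x = ∑ i ∈ s, ap (f i) v x := by
  let F : (M ⟶ N) →+ vx N v := ⟨⟨fun g => ap g v x, rfl⟩, fun _ _ => rfl⟩
  exact map_sum F f s

lemma FinDim.biproduct {ι : Type} [Finite ι] {f : ι → RepC k Q} (h : ∀ i, FinDim (f i)) :
    FinDim (⨁ f) := by
  classical
  cases nonempty_fintype ι
  intro v
  have := fun i => h i v
  refine FiniteDimensional.of_injective
    (LinearMap.pi fun i => ap (biproduct.π f i) v : _ →ₗ[k] ∀ i, vx (f i) v) ?_
  rw [injective_iff_map_eq_zero]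
  intro x hx
  have h1 : ap (∑ i, biproduct.π f i ≫ biproduct.ι f i) v x = x := by
    rw [biproduct.total, ap_id]
  rw [← h1, ap_sum]
  apply Finset.sum_eq_zero
  intro i _
  have : ap (biproduct.π f i) v x = 0 := congrFun hx i
  rw [ap_comp, this, map_zero]

lemma dimVec_ses {X Y Z : RepC k Q} {i : X ⟶ Y} {p : Y ⟶ Z}
    {w : i ≫ p = 0} (hS : (ShortComplex.mk i p w).ShortExact) (hY : FinDim Y) :
    dimVec Y = dimVec X + dimVec Z := by
  funext v
  have := hY v
  have h1 := (mono_iff_ap i).1 hS.mono_f v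
  have h2 := (epi_iff_ap p).1 hS.epi_g v
  have h3 := LinearMap.finrank_range_add_finrank_ker (ap p v)
  have h4 : LinearMap.ker (ap p v) = LinearMap.range (ap i v) := by
    ext y
    constructor
    · intro hy
      exact ap_eq_zero_of_exact hS.exact v y hy
    · rintro ⟨z, rfl⟩
      rw [LinearMap.mem_ker]
      change ap p v (ap i v z) = 0
      rw [← ap_comp, w, ap_zero]
  rw [h4, LinearMap.range_eq_top.2 h2, finrank_top, LinearMap.finrank_range_of_inj h1] at h3
  simp only [dimVec, Pi.add_apply]
  rw [← h3]
  push_cast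
  ring

def tdim (M : RepC k Q) : ℕ := ∑ v : Q.V, Module.finrank k (vx M v)

lemma tdim_cast (M : RepC k Q) : (tdim M : ℤ) = ∑ v : Q.V, dimVec M v := by
  simp [tdim, dimVec]

lemma tdim_ses {X Y Z : RepC k Q} {i : X ⟶ Y} {p : Y ⟶ Z}
    {w : i ≫ p = 0} (hS : (ShortComplex.mk i p w).ShortExact) (hY : FinDim Y) :
    tdim Y = tdim X + tdim Z := by
  have : (tdim Y : ℤ) = tdim X + tdim Z := by
    simp only [tdim_cast, dimVec_ses hS hY, Pi.add_apply, Finset.sum_add_distrib]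
  exact_mod_cast this

lemma isZero_of_tdim {M : RepC k Q} (hM : FinDim M) (h : tdim M = 0) : IsZero M := by
  rw [isZero_iff]
  intro v
  have := hM v
  rw [tdim, Finset.sum_eq_zero_iff] at h
  exact Module.finrank_zero_iff.1 (h v (Finset.mem_univ _))

lemma tdim_eq_zero {M : RepC k Q} (h : IsZero M) : tdim M = 0 := by
  rw [isZero_iff] at h
  apply Finset.sum_eq_zero
  intro v _
  have := h v
  exact Module.finrank_zero_of_subsingleton

lemma dimVec_eq_zero {M : RepC k Q} (h : IsZero M) : dimVec M = 0 := by
  rw [isZero_iff] at h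
  funext v
  have := h v
  have h2 : Module.finrank k (vx M v) = 0 := Module.finrank_zero_of_subsingleton
  simp only [dimVec, h2]
  rfl

lemma tdim_le_of_mono {M N : RepC k Q} (hN : FinDim N) (f : M ⟶ N) [Mono f] : tdim M ≤ tdim N := by
  rw [tdim_ses (ses_coker f) hN]; omega

lemma isIso_of_mono_tdim {M N : RepC k Q} (hN : FinDim N) (f : M ⟶ N) [Mono f]
    (h : tdim N ≤ tdim M) : IsIso f := by
  have h1 := tdim_ses (ses_coker f) hN
  have h2 : IsZero (cokernel f) := isZero_of_tdim (hN.of_epi (cokernel.π f)) (by omega)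
  have : Epi f := Preadditive.epi_of_isZero_cokernel f h2
  exact isIso_of_mono_of_epi f

lemma isIso_of_epi_tdim {M N : RepC k Q} (hM : FinDim M) (f : M ⟶ N) [Epi f]
    (h : tdim M ≤ tdim N) : IsIso f := by
  have h1 := tdim_ses (ses_kernel f) hM
  have h2 : IsZero (kernel f) := isZero_of_tdim (hM.of_mono (kernel.ι f)) (by omega)
  have : Mono f := Preadditive.mono_of_isZero_kernel f h2
  exact isIso_of_mono_of_epi f

lemma tdim_iso {M N : RepC k Q} (hM : FinDim M) (e : M ≅ N) : tdim M = tdim N :=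
  le_antisymm (tdim_le_of_mono (hM.of_epi e.hom) e.hom) (tdim_le_of_mono hM e.inv)

lemma exists_torsion_part {T : Set (RepC k Q)} (hT : IsTorsionClass T) {M : RepC k Q}
    (hM : FinDim M) :
    ∃ (X : RepC k Q) (i : X ⟶ M), X ∈ T ∧ Mono i ∧ ∀ Y ∈ T, HomZero Y (cokernel i) := by
  let S : Set ℕ := {n | ∃ (X : RepC k Q) (i : X ⟶ M), X ∈ T ∧ Mono i ∧ tdim X = n}
  have hne : S.Nonempty := ⟨tdim (0 : RepC k Q), 0, 0, hT.zero_mem, inferInstance, rfl⟩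
  have hbd : BddAbove S := ⟨tdim M, by
    rintro n ⟨X, i, _, hi, rfl⟩
    exact tdim_le_of_mono hM i⟩
  obtain ⟨X, i, hX, hi, hmax⟩ := Nat.sSup_mem hne hbd
  refine ⟨X, i, hX, hi, ?_⟩
  intro Y hY g
  have hI : Abelian.image g ∈ T := hT.quot_mem Y hY _ (Abelian.factorThruImage g) inferInstance
  have hk : kernel (cokernel.π i) ∈ T := hT.quot_mem X hX _ (Abelian.factorThruImage i) inferInstance
  have hZ := hT.pullback_mem (cokernel.π i) (Abelian.image.ι g) hk hI
  obtain ⟨w, hS⟩ := pullback_ses (cokernel.π i) (Abelian.image.ι g)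
  have hfZ : FinDim (pullback (cokernel.π i) (Abelian.image.ι g)) := hM.of_mono (pullback.fst _ _)
  have h1 := tdim_ses hS hfZ
  have h2 : tdim (pullback (cokernel.π i) (Abelian.image.ι g)) ≤ sSup S :=
    le_csSup hbd ⟨_, pullback.fst _ _, hZ, inferInstance, rfl⟩
  have h3 : tdim X ≤ tdim (kernel (cokernel.π i)) :=
    haveI : Mono (Abelian.factorThruImage i) := inferInstance
    tdim_le_of_mono (hM.of_mono (kernel.ι _)) (Abelian.factorThruImage i)
  have hfc : FinDim (cokernel i) := hM.of_epi (cokernel.π i)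
  have h4 : IsZero (Abelian.image g) :=
    isZero_of_tdim (hfc.of_mono (Abelian.image.ι g)) (by omega)
  rw [← Abelian.image.fac g, h4.eq_of_tgt (Abelian.factorThruImage g) 0, zero_comp]


lemma mem_gen_iff {C : Type*} [Category C] [Abelian C] {U X : C} :
    X ∈ gen {U} ↔ ∃ (n : ℕ) (p : (⨁ fun _ : Fin n => U) ⟶ X), Epi p := by
  constructor
  · rintro ⟨A, ⟨n, f, hf, i, r, hir⟩, p, hp⟩
    obtain rfl : f = fun _ => U := funext hf
    have : Epi r := (SplitEpi.mk i hir).epi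
    exact ⟨n, r ≫ p, epi_comp _ _⟩
  · rintro ⟨n, p, hp⟩
    exact ⟨_, ⟨n, fun _ => U, fun _ => rfl, 𝟙 _, 𝟙 _, by simp⟩, p, hp⟩

lemma gen_finDim {U X : RepC k Q} (hU : FinDim U) (hX : X ∈ gen {U}) : FinDim X := by
  obtain ⟨n, p, hp⟩ := mem_gen_iff.1 hX
  exact (FinDim.biproduct (fun _ => hU)).of_epi p

lemma biproduct_supp {ι : Type} [Finite ι] {f : ι → RepC k Q} {v : Q.V}
    (h : ∀ i, Subsingleton (vx (f i) v)) : Subsingleton (vx (⨁ f) v) := by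
  cases nonempty_fintype ι
  refine subsingleton_of_forall_eq 0 fun x => ?_
  have h1 : ap (∑ i, biproduct.π f i ≫ biproduct.ι f i) v x = x := by
    rw [biproduct.total, ap_id]
  rw [← h1, ap_sum]
  apply Finset.sum_eq_zero
  intro i _
  rw [ap_comp, Subsingleton.elim (ap (biproduct.π f i) v x) 0, map_zero]

lemma epi_supp {M N : RepC k Q} {v : Q.V} (p : M ⟶ N) [hp : Epi p] (h : Subsingleton (vx M v)) :
    Subsingleton (vx N v) := ((epi_iff_ap p).1 hp v).subsingleton

lemma mono_supp {M N : RepC k Q} {v : Q.V} (p : M ⟶ N) [hp : Mono p] (h : Subsingleton (vx N v)) :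
    Subsingleton (vx M v) := ((mono_iff_ap p).1 hp v).subsingleton

lemma gen_supp {U X : RepC k Q} {v : Q.V} (hU : Subsingleton (vx U v)) (hX : X ∈ gen {U}) :
    Subsingleton (vx X v) := by
  obtain ⟨n, p, hp⟩ := mem_gen_iff.1 hX
  exact epi_supp p (biproduct_supp fun _ => hU)

lemma aSet_of_mono {T : Set (RepC k Q)} (hT : IsTorsionClass T) {X B : RepC k Q} (hB : B ∈ aSet T)
    (hX : X ∈ T) (i : X ⟶ B) [Mono i] : X ∈ aSet T := by
  refine ⟨hX, fun Y hY g => ?_⟩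
  exact hT.iso_mem (hB.2 Y hY (g ≫ i)) (kernelCompMono g i)

theorem thmA {T : Set (RepC k Q)} (hT : IsTorsionClass T) (hfd : ∀ X ∈ T, FinDim X)
    (θ : (Q.V → ℤ) → ℤ) (hadd : ∀ x y, θ (x + y) = θ x + θ y)
    (h1 : ∀ X ∈ T, 0 ≤ θ (dimVec X))
    (h2 : ∀ N : RepC k Q, FinDim N → (∀ Y ∈ T, HomZero Y N) →
      θ (dimVec N) ≤ 0 ∧ (θ (dimVec N) = 0 → IsZero N))
    (h3 : ∀ B ∈ aSet T, θ (dimVec B) = 0) : aSet T = SemistableSet θ := by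
  ext M
  constructor
  · intro hB
    have hfB := hfd M hB.1
    refine ⟨hfB, h3 M hB, ?_⟩
    intro N i hi
    have hfN := hfB.of_mono i
    obtain ⟨X, j, hX, hj, hcok⟩ := exists_torsion_part hT hfN
    have hXa : X ∈ aSet T := aSet_of_mono hT hB hX (j ≫ i)
    rw [dimVec_ses (ses_coker j) hfN, hadd, h3 X hXa]
    have := (h2 _ (hfN.of_epi (cokernel.π j)) hcok).1
    linarith
  · rintro ⟨hfM, h0, hsub⟩
    have hMT : M ∈ T := by
      obtain ⟨X, j, hX, hj, hcok⟩ := exists_torsion_part hT hfM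
      have e := dimVec_ses (ses_coker j) hfM
      rw [e, hadd] at h0
      have a1 := hsub X j hj
      have a2 := h1 X hX
      have a3 := h2 _ (hfM.of_epi (cokernel.π j)) hcok
      have hz := a3.2 (by linarith)
      have : Epi j := Preadditive.epi_of_isZero_cokernel j hz
      exact hT.quot_mem X hX M j this
    refine ⟨hMT, ?_⟩
    intro Y hY g
    set g' := Abelian.factorThruImage g with hg'
    have hfY := hfd Y hY
    have hI : Abelian.image g ∈ T := hT.quot_mem Y hY _ g' inferInstance
    suffices hK : kernel g' ∈ T by
      have e1 := kernelCompMono g' (Abelian.image.ι g)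
      have e2 : kernel g ≅ kernel (g' ≫ Abelian.image.ι g) :=
        kernelIsoOfEq (Abelian.image.fac g).symm
      exact hT.iso_mem hK (e2 ≪≫ e1).symm
    have hfK := hfY.of_mono (kernel.ι g')
    obtain ⟨X, j, hX, hj, hcok⟩ := exists_torsion_part hT hfK
    have e1 := dimVec_ses (ses_kernel g') hfY
    have e2 := dimVec_ses (ses_coker j) hfK
    have e3 := dimVec_ses (ses_coker (j ≫ kernel.ι g')) hfY
    have e4 : θ (dimVec (Abelian.image g)) ≤ 0 := hsub _ (Abelian.image.ι g) inferInstance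
    have e6 := h1 _ (hT.quot_mem Y hY _ (cokernel.π (j ≫ kernel.ι g')) inferInstance)
    have e7 := h2 _ (hfK.of_epi (cokernel.π j)) hcok
    rw [e2] at e1
    rw [e1] at e3
    have e8 := congrArg θ e3
    rw [hadd, hadd, hadd] at e8
    have hz := e7.2 (by linarith)
    have : Epi j := Preadditive.epi_of_isZero_cokernel j hz
    exact hT.quot_mem X hX _ j this

lemma euler_add (Q : FinQuiver) (α x y : Q.V → ℤ) : euler Q α (x + y) = euler Q α x + euler Q α y := by
  simp only [euler, Pi.add_apply, mul_add, Finset.sum_add_distrib]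
  ring

theorem thmC {T : Set (RepC k Q)} (hT : IsTorsionClass T) (hfd : ∀ X ∈ T, FinDim X)
    {U : RepC k Q} (hgen : T ⊆ gen {U}) (J : Finset Q.V)
    (hJ : ∀ j ∈ J, Subsingleton (vx U j)) {ι : Type} [Fintype ι] (R : ι → RepC k Q)
    (hR : ∀ i, R i ∈ T) (hRext : ∀ i, ∀ X ∈ T, Ext1Zero (R i) X) (a : ι → ℤ) (ha : ∀ i, 0 ≤ a i)
    (b : Q.V → ℤ) (hb : ∀ j ∈ J, b j < 0)
    (hB : ∀ i, a i ≠ 0 → ∀ B ∈ aSet T, HomZero (R i) B)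
    (hN : ∀ N : RepC k Q, FinDim N → (∀ Y ∈ T, HomZero Y N) → (∀ j ∈ J, Subsingleton (vx N j)) →
      (∀ i, a i ≠ 0 → Ext1Zero (R i) N) → IsZero N) :
    aSet T = SemistableSet (fun d => (∑ i, a i * euler Q (dimVec (R i)) d) + ∑ j ∈ J, b j * d j) := by
  have hJ0 : ∀ X ∈ T, ∑ j ∈ J, b j * dimVec X j = 0 := by
    intro X hX
    apply Finset.sum_eq_zero
    intro j hj
    have := gen_supp (hJ j hj) (hgen hX)
    have h2 : Module.finrank k (vx X j) = 0 := Module.finrank_zero_of_subsingleton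
    simp only [dimVec, h2]
    simp
  apply thmA hT hfd
  · intro x y
    simp only [euler_add, Pi.add_apply, mul_add, Finset.sum_add_distrib]
    ring
  · intro X hX
    simp only [hJ0 X hX, add_zero]
    exact Finset.sum_nonneg fun i _ => mul_nonneg (ha i)
      (euler_nonneg (hfd _ (hR i)) (hfd _ hX) (hRext i X hX))
  · intro N hfN hNt
    have t1 : ∀ i ∈ Finset.univ, a i * euler Q (dimVec (R i)) (dimVec N) ≤ 0 := fun i _ =>
      mul_nonpos_of_nonneg_of_nonpos (ha i) (euler_nonpos (hfd _ (hR i)) hfN (hNt _ (hR i)))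
    have t2 : ∀ j ∈ J, b j * dimVec N j ≤ 0 := fun j hj =>
      mul_nonpos_of_nonpos_of_nonneg (hb j hj).le (Int.natCast_nonneg _)
    have s1 := Finset.sum_nonpos t1
    have s2 := Finset.sum_nonpos t2
    refine ⟨by linarith, fun h0 => ?_⟩
    have z1 := (Finset.sum_eq_zero_iff_of_nonpos t1).1 (by linarith)
    have z2 := (Finset.sum_eq_zero_iff_of_nonpos t2).1 (by linarith)
    apply hN N hfN hNt
    · intro j hj
      have := z2 j hj
      rcases mul_eq_zero.1 this with h | h
      · exact absurd h (hb j hj).ne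
      · have := hfN j
        exact Module.finrank_zero_iff.1 (Int.natCast_eq_zero.1 h)
    · intro i hi
      have := z1 i (Finset.mem_univ _)
      rcases mul_eq_zero.1 this with h | h
      · exact absurd h hi
      · exact ext1Zero_of_euler (hfd _ (hR i)) hfN (hNt _ (hR i)) h
  · intro B hBa
    simp only [hJ0 B hBa.1, add_zero]
    apply Finset.sum_eq_zero
    intro i _
    by_cases hi : a i = 0
    · rw [hi, zero_mul]
    · have l1 := euler_nonneg (hfd _ (hR i)) (hfd _ hBa.1) (hRext i B hBa.1)
      have l2 := euler_nonpos (hfd _ (hR i)) (hfd _ hBa.1) (hB i hi B hBa)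
      rw [le_antisymm l2 l1, mul_zero]


section Paths

lemma wf_path (Q : FinQuiver) : WellFounded (fun x y : Q.V => ∃ p : Quiver.Path x y, p.length ≠ 0) := by
  have : IsTrans Q.V (fun x y : Q.V => ∃ p : Quiver.Path x y, p.length ≠ 0) := ⟨by
    rintro x y z ⟨p, hp⟩ ⟨q, hq⟩
    exact ⟨p.comp q, by rw [Quiver.Path.length_comp]; omega⟩⟩
  have : Std.Irrefl (fun x y : Q.V => ∃ p : Quiver.Path x y, p.length ≠ 0) := ⟨by
    rintro x ⟨p, hp⟩
    rw [Q.acyclic x p] at hp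
    exact hp rfl⟩
  exact Finite.wellFounded_of_trans_of_irrefl _

lemma arrow_lt {x y : Q.V} (a : x ⟶ y) : ∃ p : Quiver.Path x y, p.length ≠ 0 :=
  ⟨a.toPath, by simp [Quiver.Hom.toPath]⟩

def pathSplit (v w : Q.V) : Quiver.Path v w →
    Option (Σ x : {x : Q.V // Nonempty (x ⟶ w)}, Quiver.Path v x.1 × (x.1 ⟶ w))
  | .nil => none
  | .cons (b := x) p a => some ⟨⟨x, ⟨a⟩⟩, p, a⟩

lemma pathSplit_inj (v w : Q.V) : Function.Injective (pathSplit v w) := by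
  intro p q h
  cases p with
  | nil => rw [Q.acyclic _ q]
  | cons p a =>
    cases q with
    | nil => exact (Q.acyclic _ _)
    | cons q b =>
      simp only [pathSplit, Option.some.injEq, Sigma.mk.injEq, Subtype.mk.injEq] at h
      obtain ⟨rfl, h2⟩ := h
      simp only [heq_eq_eq, Prod.mk.injEq] at h2
      rw [h2.1, h2.2]

instance finite_path (v w : Q.V) : Finite (Quiver.Path v w) := by
  induction w using (wf_path Q).induction with
  | _ w ih =>
    have : ∀ x : {x : Q.V // Nonempty (x ⟶ w)}, Finite (Quiver.Path v x.1) := by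
      rintro ⟨x, ⟨a⟩⟩
      exact ih x (arrow_lt a)
    exact Finite.of_injective _ (pathSplit_inj v w)

/-- path avoiding J -/
def Av (J : Finset Q.V) {v : Q.V} : {w : Q.V} → Quiver.Path v w → Prop
  | _, .nil => v ∉ J
  | _, .cons (c := c) p _ => Av J p ∧ c ∉ J

lemma Av.tgt {J : Finset Q.V} {v w : Q.V} {p : Quiver.Path v w} (h : Av J p) : w ∉ J := by
  cases p with
  | nil => exact h
  | cons p a => exact h.2

lemma Av.src {J : Finset Q.V} {v w : Q.V} {p : Quiver.Path v w} (h : Av J p) : v ∉ J := by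
  induction p with
  | nil => exact h
  | cons p a ih => exact ih h.1

end Paths

section Proj

lemma fsl {α X : Type} [AddCommGroup X] [Module k X] (g : α → X) (a : α) :
    Finsupp.lift X k α g (Finsupp.single a 1) = g a := by
  rw [Finsupp.lift_apply, Finsupp.sum_single_index (by simp), one_smul]

variable (k)

open scoped Classical in
def PV (J : Finset Q.V) (v : Q.V) : RepC k Q :=
  mkRep (fun w => ModuleCat.of k ({p : Quiver.Path v w // Av J p} →₀ k)) (fun {x y} a =>
    Finsupp.lift _ k _ (fun p : {p : Quiver.Path v x // Av J p} =>
      if h : Av J (p.1.cons a) then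
        (Finsupp.single (⟨p.1.cons a, h⟩ : {p : Quiver.Path v y // Av J p}) (1 : k)) else 0))

variable {k}

def pb (J : Finset Q.V) {v w : Q.V} (p : Quiver.Path v w) (h : Av J p) : vx (PV k J v) w :=
  (Finsupp.single (⟨p, h⟩ : {p : Quiver.Path v w // Av J p}) (1 : k))

open scoped Classical in
lemma ar_pb (J : Finset Q.V) {v x y : Q.V} (p : Quiver.Path v x) (h : Av J p) (a : x ⟶ y) :
    ar (PV k J v) a (pb J p h) = if h : Av J (p.cons a) then pb J (p.cons a) h else 0 := by
  refine (ar_mkRep _ _ a _).trans ?_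
  exact fsl (fun p : {p : Quiver.Path v x // Av J p} =>
      if h : Av J (p.1.cons a) then
        (Finsupp.single (⟨p.1.cons a, h⟩ : {p : Quiver.Path v y // Av J p}) (1 : k)) else 0) ⟨p, h⟩

def InA (J : Finset Q.V) (M : RepC k Q) : Prop := FinDim M ∧ ∀ j ∈ J, Subsingleton (vx M j)

lemma PV_inA (J : Finset Q.V) (v : Q.V) : InA J (PV k J v) := by
  constructor
  · intro w
    exact inferInstanceAs (FiniteDimensional k ({p : Quiver.Path v w // Av J p} →₀ k))
  · intro j hj
    have : IsEmpty {p : Quiver.Path v j // Av J p} := ⟨fun p => p.2.tgt hj⟩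
    exact inferInstanceAs (Subsingleton ({p : Quiver.Path v j // Av J p} →₀ k))

open scoped Classical in
def gn (J : Finset Q.V) (v : Q.V) : vx (PV k J v) v :=
  if h : v ∈ J then 0 else pb J Quiver.Path.nil (show Av J Quiver.Path.nil from h)

lemma gn_eq {J : Finset Q.V} {v : Q.V} (h : Av J (Quiver.Path.nil : Quiver.Path v v)) :
    gn J v = (pb J Quiver.Path.nil h : vx (PV k J v) v) := by
  have h' : v ∉ J := h
  rw [gn, dif_neg h']

lemma ap_pb {J : Finset Q.V} {v : Q.V} {N : RepC k Q} (f : PV k J v ⟶ N) {w : Q.V}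
    (p : Quiver.Path v w) (h : Av J p) : ap f w (pb J p h) = pm N p (ap f v (gn J v)) := by
  induction p with
  | nil =>
    rw [pm_nil, gn_eq h]
  | cons p a ih =>
    rw [pm_cons, ← ih h.1, ← ap_nat, ar_pb, dif_pos h]

lemma lin_ext_pb {J : Finset Q.V} {v w : Q.V} {X : Type} [AddCommGroup X] [Module k X]
    (f g : vx (PV k J v) w →ₗ[k] X) (h : ∀ p hp, f (pb J p hp) = g (pb J p hp)) : f = g := by
  refine Finsupp.lhom_ext' (α := {p : Quiver.Path v w // Av J p}) (M := k) (R := k)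
    (φ := f) (ψ := g) ?_
  rintro ⟨p, hp⟩
  refine LinearMap.ext_ring ?_
  exact h p hp

lemma PV_ext {J : Finset Q.V} {v : Q.V} {N : RepC k Q} {f g : PV k J v ⟶ N}
    (h : ap f v (gn J v) = ap g v (gn J v)) : f = g := by
  apply rhom_ext
  intro w x
  refine LinearMap.congr_fun (lin_ext_pb (ap f w) (ap g w) ?_) x
  intro p hp
  rw [ap_pb, ap_pb, h]

def pvLiftLin (J : Finset Q.V) {v : Q.V} (N : RepC k Q) (x : vx N v) (w : Q.V) :
    vx (PV k J v) w →ₗ[k] vx N w :=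
  (Finsupp.lift _ k _ (fun p : {p : Quiver.Path v w // Av J p} => pm N p.1 x))

lemma pvLiftLin_pb (J : Finset Q.V) {v : Q.V} (N : RepC k Q) (x : vx N v) (w : Q.V)
    (p : Quiver.Path v w) (h : Av J p) : pvLiftLin J N x w (pb J p h) = pm N p x := by
  exact fsl (fun p : {p : Quiver.Path v w // Av J p} => pm N p.1 x) ⟨p, h⟩

lemma PV_lift {J : Finset Q.V} {v : Q.V} {N : RepC k Q} (hN : ∀ j ∈ J, Subsingleton (vx N j))
    (x : vx N v) : ∃ f : PV k J v ⟶ N, ap f v (gn J v) = x := by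
  classical
  refine ⟨mkHom (pvLiftLin J N x) ?_, ?_⟩
  · intro y z a m
    refine LinearMap.congr_fun (lin_ext_pb ((pvLiftLin J N x z).comp (ar (PV k J v) a))
      ((ar N a).comp (pvLiftLin J N x y)) ?_) m
    intro p hp
    rw [LinearMap.comp_apply, LinearMap.comp_apply, ar_pb, pvLiftLin_pb]
    by_cases h : Av J (p.cons a)
    · rw [dif_pos h, pvLiftLin_pb, pm_cons]
    · have hz : z ∈ J := by
        by_contra hz
        exact h ⟨hp, hz⟩
      have := hN z hz
      exact Subsingleton.elim _ _
  · rw [ap_mkHom]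
    by_cases h : v ∈ J
    · have := hN v h
      exact Subsingleton.elim _ _
    · have h' : Av J (Quiver.Path.nil : Quiver.Path v v) := h
      rw [gn_eq h', pvLiftLin_pb, pm_nil]

def ProjA (J : Finset Q.V) (P : RepC k Q) : Prop :=
  InA J P ∧ ∀ X : RepC k Q, (∀ j ∈ J, Subsingleton (vx X j)) → Ext1Zero P X

lemma ses_supp {X Y Z : RepC k Q} {i : X ⟶ Y} {p : Y ⟶ Z}
    {w : i ≫ p = 0} (hS : (ShortComplex.mk i p w).ShortExact) {v : Q.V}
    (hX : Subsingleton (vx X v)) (hZ : Subsingleton (vx Z v)) : Subsingleton (vx Y v) := by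
  refine subsingleton_of_forall_eq 0 fun y => ?_
  obtain ⟨x, hx⟩ := ap_eq_zero_of_exact hS.exact v y (hZ.elim _ _)
  rw [← hx, hX.elim x 0, map_zero]

lemma PV_section {J : Finset Q.V} {v : Q.V} {X : RepC k Q} (hX : ∀ j ∈ J, Subsingleton (vx X j))
    (p : X ⟶ PV k J v) [hp : Epi p] : ∃ s : PV k J v ⟶ X, s ≫ p = 𝟙 _ := by
  obtain ⟨x, hx⟩ := (epi_iff_ap p).1 hp v (gn J v)
  obtain ⟨s, hs⟩ := PV_lift hX x
  refine ⟨s, PV_ext ?_⟩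
  rw [ap_comp, hs, hx, ap_id]

lemma PV_proj (J : Finset Q.V) (v : Q.V) : ProjA J (PV k J v) := by
  refine ⟨PV_inA J v, fun X hX => ext1Zero_of_section ?_⟩
  intro E i p w hS
  have : Epi p := hS.epi_g
  exact PV_section (fun j hj => ses_supp hS (hX j hj) ((PV_inA J v).2 j hj)) p

lemma ProjA.of_mono {J : Finset Q.V} {P P' : RepC k Q} (h : ProjA J P) (f : P' ⟶ P) [Mono f] :
    ProjA J P' :=
  ⟨⟨h.1.1.of_mono f, fun j hj => mono_supp f (h.1.2 j hj)⟩, fun X hX => (h.2 X hX).of_mono f⟩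

lemma ProjA.biproduct {J : Finset Q.V} {ι : Type} [Finite ι] {P : ι → RepC k Q}
    (h : ∀ i, ProjA J (P i)) : ProjA J (⨁ P) :=
  ⟨⟨FinDim.biproduct fun i => (h i).1.1, fun j hj => biproduct_supp fun i => (h i).1.2 j hj⟩,
    fun X hX => Ext1Zero.biproduct_left P fun i => (h i).2 X hX⟩

lemma enough_proj {J : Finset Q.V} {M : RepC k Q} (hM : InA J M) :
    ∃ (P : RepC k Q) (e : P ⟶ M), ProjA J P ∧ Epi e := by
  have := hM.1
  unfold FinDim at this
  let ι : Type := Σ v : Q.V, Fin (Module.finrank k (vx M v))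
  let bs : ∀ v, Module.Basis (Fin (Module.finrank k (vx M v))) k (vx M v) := fun v =>
    Module.finBasis k (vx M v)
  choose f hf using fun i : ι => PV_lift hM.2 (bs i.1 i.2)
  refine ⟨⨁ fun i : ι => PV k J i.1, biproduct.desc f, ProjA.biproduct fun i => PV_proj J _, ?_⟩
  rw [epi_iff_ap]
  intro v
  rw [← LinearMap.range_eq_top, eq_top_iff, ← (bs v).span_eq, Submodule.span_le]
  rintro _ ⟨i, rfl⟩
  refine ⟨ap (biproduct.ι (fun i : ι => PV k J i.1) ⟨v, i⟩) v (gn J v), ?_⟩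
  rw [← ap_comp, biproduct.ι_desc, hf]

end Proj

section Simples

open scoped Classical in
def sSub (k : Type) [Field k] {Q : FinQuiver} (v w : Q.V) : Submodule k k := if w = v then ⊤ else ⊥

variable (k) in
def SV (v : Q.V) : RepC k Q := mkRep (fun w => ModuleCat.of k (sSub k v w)) (fun _ => 0)

lemma SV_sub {v w : Q.V} (h : w ≠ v) : Subsingleton (vx (SV k v) w) := by
  change Subsingleton (sSub k v w)
  rw [sSub, if_neg h]
  infer_instance

lemma SV_rank (v : Q.V) : Module.finrank k (vx (SV k v) v) = 1 := by
  change Module.finrank k (sSub k v v) = 1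
  rw [sSub, if_pos rfl, finrank_top, Module.finrank_self]

lemma SV_fd (v : Q.V) : FinDim (SV k v) := by
  intro w
  exact inferInstanceAs (FiniteDimensional k (sSub k v w))

lemma SV_tdim (v : Q.V) : tdim (SV k v) = 1 := by
  classical
  rw [tdim, Finset.sum_eq_single v]
  · exact SV_rank v
  · intro w _ hw
    have := SV_sub (k := k) hw
    exact Module.finrank_zero_of_subsingleton
  · intro h
    exact absurd (Finset.mem_univ v) h

lemma SV_simple (v : Q.V) : Simple (SV k v) where
  mono_isIso_iff_nonzero := by
    intro Y f hf
    constructor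
    · intro hi h
      subst h
      have hz : IsZero (SV k v) := by
        rw [IsZero.iff_id_eq_zero]
        rw [← IsIso.inv_hom_id (0 : Y ⟶ SV k v), comp_zero]
      have := tdim_eq_zero hz
      rw [SV_tdim] at this
      omega
    · intro h
      apply isIso_of_mono_tdim (SV_fd v)
      rw [SV_tdim]
      by_contra hlt
      have hz := isZero_of_tdim ((SV_fd v).of_mono f) (by omega)
      exact h (hz.eq_of_src _ _)

lemma exists_top {K : RepC k Q} (hK : ¬ IsZero K) :
    ∃ v, ¬ Subsingleton (vx K v) ∧ ∃ f : K ⟶ SV k v, f ≠ 0 := by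
  classical
  have hne : {v : Q.V | ¬ Subsingleton (vx K v)}.Nonempty := by
    rw [isZero_iff] at hK
    push Not at hK
    obtain ⟨v, hv⟩ := hK
    exact ⟨v, not_subsingleton_iff_nontrivial.2 hv⟩
  obtain ⟨v, hv, hmin⟩ := (wf_path Q).has_min _ hne
  refine ⟨v, hv, ?_⟩
  have hv' : Nontrivial (vx K v) := not_subsingleton_iff_nontrivial.1 hv
  obtain ⟨x, hx⟩ := exists_ne (0 : vx K v)
  obtain ⟨l, hl⟩ : ∃ l : vx K v →ₗ[k] k, l x ≠ 0 := by
    by_contra! h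
    exact hx ((Module.forall_dual_apply_eq_zero_iff k x).1 h)
  let L : ∀ w : Q.V, vx K w →ₗ[k] k := Pi.single (M := fun w => vx K w →ₗ[k] k) v l
  have hL : ∀ w m, L w m ∈ sSub k v w := by
    intro w m
    unfold sSub
    split_ifs with h
    · trivial
    · have : L w = 0 := Pi.single_eq_of_ne (M := fun w => vx K w →ₗ[k] k) h l
      rw [this, LinearMap.zero_apply]
      exact Submodule.zero_mem _
  refine ⟨mkHom (N := SV k v) (fun w => LinearMap.codRestrict (sSub k v w) (L w) (hL w)) ?_, ?_⟩
  · intro y z a m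
    have hr : ar (SV k v) a = 0 := rfl
    rw [hr, LinearMap.zero_apply]
    by_cases hz : z = v
    · subst hz
      have : Subsingleton (vx K y) := by
        by_contra h
        exact hmin y h (arrow_lt a)
      rw [Subsingleton.elim m 0, map_zero]
      exact map_zero (LinearMap.codRestrict (sSub k z z) (L z) (hL z))
    · have := SV_sub (k := k) hz
      exact this.elim _ _
  · intro h
    have h1 := congrArg (fun f => ap f v x) h
    have h2 : L v x = 0 := congrArg Subtype.val h1
    rw [show L v = l from Pi.single_eq_same (M := fun w => vx K w →ₗ[k] k) v l] at h2
    exact hl h2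

lemma PV_span (v : Q.V) (y : vx (PV k (∅ : Finset Q.V) v) v) : ∃ c : k, y = c • gn ∅ v := by
  have ht : (Submodule.mkQ (Submodule.span k {(gn ∅ v : vx (PV k (∅ : Finset Q.V) v) v)})) = 0 := by
    apply lin_ext_pb
    intro p hp
    obtain rfl := Q.acyclic v p
    rw [LinearMap.zero_apply, Submodule.mkQ_apply, Submodule.Quotient.mk_eq_zero, ← gn_eq hp]
    exact Submodule.mem_span_singleton_self _
  have h2 := LinearMap.congr_fun ht y
  rw [LinearMap.zero_apply, Submodule.mkQ_apply, Submodule.Quotient.mk_eq_zero] at h2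
  obtain ⟨c, hc⟩ := Submodule.mem_span_singleton.1 h2
  exact ⟨c, hc.symm⟩

lemma SV_one (v : Q.V) : ∃ s : vx (SV k v) v, ∀ z : vx (SV k v) v, ∃ c : k, c • s = z := by
  have h := SV_rank (k := k) v
  obtain ⟨s, _, hs⟩ := finrank_eq_one_iff'.1 h
  exact ⟨s, hs⟩

lemma SV_subquot {M : RepC k Q} {v : Q.V} (h : ¬ Subsingleton (vx M v)) :
    IsSubquotient (SV k v) M := by
  have hv' : Nontrivial (vx M v) := not_subsingleton_iff_nontrivial.1 h
  obtain ⟨x, hx⟩ := exists_ne (0 : vx M v)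
  obtain ⟨f, hf⟩ := PV_lift (J := ∅) (N := M) (by simp) x
  obtain ⟨s, hs⟩ := SV_one (k := k) v
  obtain ⟨q, hq⟩ := PV_lift (J := ∅) (N := SV k v) (v := v) (by simp) s
  have hinj : ∀ y, ap f v y = 0 → y = 0 := by
    intro y hy
    obtain ⟨c, rfl⟩ := PV_span v y
    rw [map_smul, hf] at hy
    have hc0 : c = 0 := (smul_eq_zero.1 hy).resolve_right hx
    rw [hc0, zero_smul]
  have hfac : ∀ w y, ap f w y = ap (Abelian.image.ι f) w (ap (Abelian.factorThruImage f) w y) := by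
    intro w y
    rw [← ap_comp, Abelian.image.fac]
  have hz : kernel.ι (Abelian.factorThruImage f) ≫ q = 0 := by
    apply rhom_ext
    intro w y
    by_cases hw : w = v
    · subst hw
      have h1 : ap f w (ap (kernel.ι (Abelian.factorThruImage f)) w y) = 0 := by
        rw [hfac, ap_kernel_cond, map_zero]
      exact (congrArg (ap q w) (hinj _ h1)).trans (map_zero (ap q w))
    · have := SV_sub (k := k) hw
      exact this.elim _ _
  have hqe : Epi q := by
    rw [epi_iff_ap]
    intro w
    by_cases hw : w = v
    · subst hw
      intro z
      obtain ⟨c, hc⟩ := hs z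
      refine ⟨c • gn ∅ w, ?_⟩
      rw [map_smul, hq, hc]
    · intro z
      have := SV_sub (k := k) hw
      exact ⟨0, this.elim _ _⟩
  refine ⟨Abelian.image f, Abelian.image.ι f, Abelian.epiDesc (Abelian.factorThruImage f) q hz,
    inferInstance, ?_⟩
  have : Epi (Abelian.factorThruImage f ≫ Abelian.epiDesc (Abelian.factorThruImage f) q hz) := by
    rw [Abelian.comp_epiDesc]; exact hqe
  exact epi_of_epi (Abelian.factorThruImage f) _

lemma subquot_supp {X M : RepC k Q} (h : IsSubquotient X M) {v : Q.V} (hM : Subsingleton (vx M v)) :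
    Subsingleton (vx X v) := by
  obtain ⟨N, i, p, hi, hp⟩ := h
  exact epi_supp p (mono_supp i hM)

lemma suppLE_iff {M U : RepC k Q} :
    SuppLE M U ↔ ∀ v, Subsingleton (vx U v) → Subsingleton (vx M v) := by
  constructor
  · intro h v hU
    by_contra hM
    have h1 := subquot_supp (h _ (SV_simple v) (SV_subquot hM)) hU
    have h2 := SV_rank (k := k) v
    have : Module.finrank k (vx (SV k v) v) = 0 := Module.finrank_zero_of_subsingleton
    omega
  · intro h S hS hSM
    obtain ⟨v, hv, f, hf⟩ := exists_top (Simple.not_isZero S)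
    have hU : ¬ Subsingleton (vx U v) := fun hU => hv (subquot_supp hSM (h v hU))
    obtain ⟨N, i, p, hi, hp⟩ := SV_subquot hU
    have := SV_simple (k := k) v
    have hiso : IsIso f := isIso_of_hom_simple hf
    exact ⟨N, i, p ≫ inv f, hi, epi_comp _ _⟩

end Simples


section Approx

/-- standing data: torsion class with a generator supported off J -/
structure Setup (T : Set (RepC k Q)) (U : RepC k Q) (J : Finset Q.V) : Prop where
  tors : IsTorsionClass T
  fd : ∀ X ∈ T, FinDim X
  mem : U ∈ T
  le : T ⊆ gen {U}
  supp : ∀ j, j ∈ J ↔ Subsingleton (vx U j)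

lemma Setup.sup {T : Set (RepC k Q)} {U : RepC k Q} {J : Finset Q.V} (h : Setup T U J)
    {X : RepC k Q} (hX : X ∈ T) : ∀ j ∈ J, Subsingleton (vx X j) := fun j hj =>
  gen_supp ((h.supp j).1 hj) (h.le hX)

structure IsApp (T : Set (RepC k Q)) {P T' : RepC k Q} (i : P ⟶ T') : Prop where
  mem : T' ∈ T
  ext : ∀ X ∈ T, ∀ f : P ⟶ X, ∃ g : T' ⟶ X, i ≫ g = f
  min : ∀ φ : T' ⟶ T', i ≫ φ = i → IsIso φ

lemma hom_finite {M N : RepC k Q} (hM : FinDim M) (hN : FinDim N) : Module.Finite k (M ⟶ N) := by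
  have := hM
  have := hN
  unfold FinDim at *
  let F : (M ⟶ N) →ₗ[k] (∀ v : Q.V, vx M v →ₗ[k] vx N v) :=
    { toFun := fun f v => ap f v
      map_add' := fun _ _ => rfl
      map_smul' := fun _ _ => rfl }
  refine Module.Finite.of_injective F ?_
  intro f g h
  apply rhom_ext
  intro v x
  exact LinearMap.congr_fun (congrFun h v) x

lemma Setup.mul_mem {T : Set (RepC k Q)} {U : RepC k Q} {J : Finset Q.V} (h : Setup T U J) (n : ℕ) :
    (⨁ fun _ : Fin n => U) ∈ T := by
  induction n with
  | zero =>
    apply h.tors.isZero_mem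
    rw [IsZero.iff_id_eq_zero]
    apply biproduct.hom_ext
    intro j
    exact j.elim0
  | succ n ih =>
    refine h.tors.quot_mem _ (h.tors.sum_mem _ h.mem _ ih) _
      (biprod.desc (biproduct.ι (fun _ : Fin (n+1) => U) 0)
        (biproduct.desc fun i : Fin n => biproduct.ι (fun _ : Fin (n+1) => U) i.succ)) ?_
    rw [Preadditive.epi_iff_cancel_zero]
    intro Z g hg
    apply biproduct.hom_ext'
    intro j
    rw [comp_zero]
    refine Fin.cases ?_ (fun j => ?_) j
    · have := biprod.inl ≫= hg
      simpa using this
    · have := (biproduct.ι (fun _ : Fin n => U) j ≫ biprod.inr) ≫= hg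
      simpa using this

lemma exists_preapprox {T : Set (RepC k Q)} {U : RepC k Q} {J : Finset Q.V} (h : Setup T U J)
    {P : RepC k Q} (hP : ProjA J P) :
    ∃ (T' : RepC k Q) (i : P ⟶ T'), T' ∈ T ∧ ∀ X ∈ T, ∀ f : P ⟶ X, ∃ g : T' ⟶ X, i ≫ g = f := by
  have := hom_finite hP.1.1 (h.fd U h.mem)
  let bs := Module.finBasis k (P ⟶ U)
  refine ⟨⨁ fun _ : Fin (Module.finrank k (P ⟶ U)) => U, biproduct.lift fun i => bs i,
    h.mul_mem _, ?_⟩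
  intro X hX f
  obtain ⟨n, p, hp⟩ := mem_gen_iff.1 (h.le hX)
  obtain ⟨l, hl⟩ := Ext1Zero.lift p (hP.2 _ fun j hj =>
    mono_supp (kernel.ι p) (h.sup (h.mul_mem n) j hj)) f
  have key : ∀ j : Fin n, ∃ g : (⨁ fun _ : Fin (Module.finrank k (P ⟶ U)) => U) ⟶ U,
      (biproduct.lift fun i => bs i) ≫ g = l ≫ biproduct.π _ j := by
    intro j
    refine ⟨biproduct.desc fun i => (bs.repr (l ≫ biproduct.π _ j) i) • 𝟙 U, ?_⟩
    rw [biproduct.lift_desc]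
    simp only [Linear.comp_smul, Category.comp_id]
    exact bs.sum_repr _
  choose g hg using key
  refine ⟨biproduct.lift g ≫ p, ?_⟩
  rw [← hl, ← Category.assoc]
  congr 1
  apply biproduct.hom_ext
  intro j
  rw [Category.assoc, biproduct.lift_π, hg]

lemma exists_approx {T : Set (RepC k Q)} {U : RepC k Q} {J : Finset Q.V} (h : Setup T U J)
    {P : RepC k Q} (hP : ProjA J P) : ∃ (T' : RepC k Q) (i : P ⟶ T'), IsApp T i := by
  let S : Set ℕ := {n | ∃ (T' : RepC k Q) (i : P ⟶ T'), T' ∈ T ∧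
    (∀ X ∈ T, ∀ f : P ⟶ X, ∃ g : T' ⟶ X, i ≫ g = f) ∧ tdim T' = n}
  have hne : S.Nonempty := by
    obtain ⟨T', i, h1, h2⟩ := exists_preapprox h hP
    exact ⟨_, T', i, h1, h2, rfl⟩
  obtain ⟨T', i, h1, h2, h3⟩ := Nat.sInf_mem hne
  refine ⟨T', i, h1, h2, ?_⟩
  intro φ hφ
  have hI : Abelian.image φ ∈ T := h.tors.quot_mem _ h1 _ (Abelian.factorThruImage φ) inferInstance
  have hle : sInf S ≤ tdim (Abelian.image φ) := by
    apply Nat.sInf_le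
    refine ⟨_, i ≫ Abelian.factorThruImage φ, hI, ?_, rfl⟩
    intro X hX f
    obtain ⟨g, hg⟩ := h2 X hX f
    refine ⟨Abelian.image.ι φ ≫ g, ?_⟩
    rw [Category.assoc, ← Category.assoc (Abelian.factorThruImage φ), Abelian.image.fac,
      ← Category.assoc, hφ, hg]
  rw [← h3] at hle
  have i1 : IsIso (Abelian.image.ι φ) := isIso_of_mono_tdim (h.fd _ h1) _ hle
  have i2 : IsIso (Abelian.factorThruImage φ) := isIso_of_epi_tdim (h.fd _ h1) _ hle
  rw [← Abelian.image.fac φ]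
  infer_instance

variable {T : Set (RepC k Q)} {U : RepC k Q} {J : Finset Q.V} {P T' : RepC k Q} {i : P ⟶ T'}

lemma IsApp.section' (hi : IsApp T i) (h : Setup T U J) (hP : ProjA J P) {X : RepC k Q} (hX : X ∈ T)
    (p : X ⟶ T') [Epi p] : ∃ s : T' ⟶ X, s ≫ p = 𝟙 T' := by
  obtain ⟨l, hl⟩ := Ext1Zero.lift p (hP.2 _ fun j hj => mono_supp (kernel.ι p) (h.sup hX j hj)) i
  obtain ⟨s, hs⟩ := hi.ext X hX l
  have := hi.min (s ≫ p) (by rw [← Category.assoc, hs, hl])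
  exact ⟨inv (s ≫ p) ≫ s, by rw [Category.assoc, IsIso.inv_hom_id]⟩

lemma IsApp.split (hi : IsApp T i) (h : Setup T U J) (hP : ProjA J P) : SplitProjIn T T' :=
  ⟨hi.mem, fun _ hX p hp => hi.section' h hP hX p⟩

lemma IsApp.extT' (hi : IsApp T i) (h : Setup T U J) (hP : ProjA J P) {X : RepC k Q} (hX : X ∈ T) :
    Ext1Zero T' X := by
  apply ext1Zero_of_section
  intro E j p w hS
  have : Epi p := hS.epi_g
  exact hi.section' h hP (h.tors.ses_mem hS hX hi.mem) p

lemma IsApp.mono (hi : IsApp T i) (h : Setup T U J) (hP : ProjA J P) : Mono i := by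
  have hK : ∀ X ∈ T, HomZero (kernel i) X := by
    intro X hX f
    have h1 : Ext1Zero (cokernel (kernel.ι i)) X :=
      (hi.extT' h hP hX).of_mono (Abelian.factorThruCoimage i)
    obtain ⟨f', hf'⟩ := Ext1Zero.extend (kernel.ι i) h1 f
    obtain ⟨g, hg⟩ := hi.ext X hX f'
    rw [← hf', ← hg, kernel.condition_assoc, zero_comp]
  have hPK := hP.of_mono (kernel.ι i)
  by_contra hm
  have hz : ¬ IsZero (kernel i) := fun hz => hm (Preadditive.mono_of_isZero_kernel i hz)
  obtain ⟨v, hv, f, hf⟩ := exists_top hz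
  have hvJ : v ∉ J := fun hj => hv (hPK.1.2 v hj)
  rw [h.supp] at hvJ
  obtain ⟨N, j, p, hj, hp⟩ := SV_subquot hvJ
  obtain ⟨l, hl⟩ := Ext1Zero.lift p (hPK.2 _ fun x hx =>
    mono_supp (kernel.ι p ≫ j) (h.sup h.mem x hx)) f
  have h0 := hK U h.mem (l ≫ j)
  have h1 : l = 0 := by rwa [← cancel_mono j, zero_comp]
  exact hf (by rw [← hl, h1, zero_comp])

lemma IsApp.coker_mem (hi : IsApp T i) (h : Setup T U J) : cokernel i ∈ T :=
  h.tors.quot_mem _ hi.mem _ (cokernel.π i) inferInstance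

lemma IsApp.extCoker (hi : IsApp T i) (h : Setup T U J) (hP : ProjA J P) {X : RepC k Q}
    (hX : X ∈ T) : Ext1Zero (cokernel i) X := by
  apply ext1Zero_of_section
  intro E j p w hS
  have : Epi p := hS.epi_g
  have : Mono j := hS.mono_f
  have e : kernel p ≅ X := (kernelIsKernel p).conePointUniqueUpToIso hS.fIsKernel
  obtain ⟨l, hl⟩ := Ext1Zero.lift p ((hi.extT' h hP hX).of_iso_right e) (cokernel.π i)
  have h0 : (i ≫ l) ≫ p = 0 := by rw [Category.assoc, hl, cokernel.condition]
  obtain ⟨f, hf⟩ := hS.exact.lift' (i ≫ l) h0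
  obtain ⟨g, hg⟩ := hi.ext X hX f
  dsimp at hf
  have h1 : i ≫ (l - g ≫ j) = 0 := by
    rw [Preadditive.comp_sub, ← Category.assoc, hg, hf, sub_self]
  refine ⟨cokernel.desc i (l - g ≫ j) h1, ?_⟩
  rw [← cancel_epi (cokernel.π i), cokernel.π_desc_assoc, Preadditive.sub_comp, Category.assoc, w,
    comp_zero, sub_zero, hl, Category.comp_id]

lemma IsApp.coker_hom (hi : IsApp T i) {B : RepC k Q} (hB : B ∈ aSet T) : HomZero (cokernel i) B := by
  intro f
  have hK := hB.2 _ hi.mem (cokernel.π i ≫ f)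
  have h0 : i ≫ cokernel.π i ≫ f = 0 := by rw [cokernel.condition_assoc, zero_comp]
  obtain ⟨g, hg⟩ := hi.ext _ hK (kernel.lift (cokernel.π i ≫ f) i h0)
  have := hi.min (g ≫ kernel.ι _) (by rw [← Category.assoc, hg, kernel.lift_ι])
  rw [← cancel_epi (cokernel.π i), ← cancel_epi (g ≫ kernel.ι (cokernel.π i ≫ f)), Category.assoc,
    kernel.condition, comp_zero, comp_zero, comp_zero]

lemma IsApp.homZero (hi : IsApp T i) (h : Setup T U J) (hP : ProjA J P) {N : RepC k Q}
    (hN : ∀ Y ∈ T, HomZero Y N) (hE : Ext1Zero (cokernel i) N) : HomZero P N := by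
  intro f
  have := hi.mono h hP
  obtain ⟨g, hg⟩ := Ext1Zero.extend i hE f
  rw [← hg, hN _ hi.mem g, comp_zero]

end Approx


section GenC
variable {C : Type*} [Category C] [Abelian C]

lemma mem_gen_of {U X : C} {ι : Type} [Finite ι] (g : ι → (U ⟶ X))
    (h : ∀ (Z : C) (f : X ⟶ Z), (∀ i, g i ≫ f = 0) → f = 0) : X ∈ gen {U} := by
  obtain ⟨n, ⟨e⟩⟩ := Finite.exists_equiv_fin ι
  rw [mem_gen_iff]
  refine ⟨n, biproduct.desc fun i => g (e.symm i), ?_⟩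
  rw [Preadditive.epi_iff_cancel_zero]
  intro Z f hf
  apply h
  intro i
  have := (biproduct.ι (fun _ : Fin n => U) (e i)) ≫= hf
  rw [← Category.assoc, biproduct.ι_desc, comp_zero, e.symm_apply_apply] at this
  exact this

lemma of_mem_gen {U X : C} (hX : X ∈ gen {U}) : ∃ (n : ℕ) (g : Fin n → (U ⟶ X)),
    ∀ (Z : C) (f : X ⟶ Z), (∀ i, g i ≫ f = 0) → f = 0 := by
  obtain ⟨n, p, hp⟩ := mem_gen_iff.1 hX
  refine ⟨n, fun i => biproduct.ι (fun _ : Fin n => U) i ≫ p, ?_⟩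
  intro Z f h
  rw [← cancel_epi p, comp_zero]
  apply biproduct.hom_ext'
  intro j
  rw [comp_zero, ← h j, Category.assoc]

lemma gen_quot {U X Y : C} (hX : X ∈ gen {U}) (p : X ⟶ Y) [Epi p] : Y ∈ gen {U} := by
  obtain ⟨n, q, hq⟩ := mem_gen_iff.1 hX
  exact mem_gen_iff.2 ⟨n, q ≫ p, epi_comp _ _⟩

lemma gen_tors {U : C} (hext : ∀ (X E Y : C) (i : X ⟶ E) (p : E ⟶ Y) (w : i ≫ p = 0),
    (ShortComplex.mk i p w).ShortExact → X ∈ gen {U} → Y ∈ gen {U} → E ∈ gen {U}) :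
    IsTorsionClass (gen {U}) where
  zero_mem := mem_gen_of (ι := Fin 0) (fun i => i.elim0)
    (fun Z f _ => (isZero_zero C).eq_of_src _ _)
  sum_mem := by
    intro X hX Y hY
    obtain ⟨n, g, hg⟩ := of_mem_gen hX
    obtain ⟨m, g', hg'⟩ := of_mem_gen hY
    refine mem_gen_of (ι := Fin n ⊕ Fin m)
      (Sum.elim (fun i => g i ≫ biprod.inl) (fun i => g' i ≫ biprod.inr)) ?_
    intro Z f h
    apply biprod.hom_ext'
    · rw [comp_zero]
      exact hg _ _ fun i => by simpa using h (Sum.inl i)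
    · rw [comp_zero]
      exact hg' _ _ fun i => by simpa using h (Sum.inr i)
  summand_mem := by
    rintro X hX Y ⟨i, r, h⟩
    have : Epi r := (SplitEpi.mk i h).epi
    exact gen_quot hX r
  quot_mem := fun X hX Y p hp => gen_quot hX p
  ext_mem := fun S hS h1 h3 => hext _ _ _ S.f S.g S.zero hS h1 h3

lemma self_mem_gen (U : C) : U ∈ gen {U} :=
  mem_gen_of (ι := Fin 1) (fun _ => 𝟙 U) (fun Z f h => by simpa using h 0)

end GenC

lemma isZero_of_PV {J : Finset Q.V} {N : RepC k Q} (hN : ∀ j ∈ J, Subsingleton (vx N j))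
    (h : ∀ v, HomZero (PV k J v) N) : IsZero N := by
  rw [isZero_iff]
  intro v
  refine subsingleton_of_forall_eq 0 fun x => ?_
  obtain ⟨f, hf⟩ := PV_lift hN x
  rw [← hf, h v f, ap_zero]

lemma exists_coeff (θ : (Q.V → ℤ) → ℤ) (hadd : ∀ x y, θ (x + y) = θ x + θ y) :
    ∃ c : Q.V → ℤ, θ = fun d => ∑ v, c v * d v := by
  classical
  let F : (Q.V → ℤ) →ₗ[ℤ] ℤ := (AddMonoidHom.mk' θ hadd).toIntLinearMap
  refine ⟨fun v => F (fun j => if v = j then 1 else 0), ?_⟩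
  funext d
  have := LinearMap.pi_apply_eq_sum_univ F d
  refine this.trans ?_
  refine Finset.sum_congr rfl fun v _ => ?_
  rw [smul_eq_mul, mul_comm]

section Part2

variable {A : Set (RepC k Q)} {U : RepC k Q}

lemma wide_iso {C : Type*} [Category C] [Abelian C] {A : Set C} (hA : IsWide A) {X Y : C}
    (hX : X ∈ A) (e : Y ≅ X) : Y ∈ A := hA.summand_mem X hX Y ⟨e.hom, e.inv, e.hom_inv_id⟩

lemma wide_mul {C : Type*} [Category C] [Abelian C] {A : Set C} (hA : IsWide A) {U : C}
    (hU : U ∈ A) (n : ℕ) : (⨁ fun _ : Fin n => U) ∈ A := by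
  induction n with
  | zero =>
    refine wide_iso hA hA.zero_mem (IsZero.isoZero ?_)
    rw [IsZero.iff_id_eq_zero]
    apply biproduct.hom_ext
    intro j
    exact j.elim0
  | succ n ih =>
    refine hA.summand_mem _ (hA.sum_mem _ hU _ ih) _
      ⟨biprod.lift (biproduct.π (fun _ : Fin (n+1) => U) 0)
        (biproduct.lift fun i : Fin n => biproduct.π (fun _ : Fin (n+1) => U) i.succ),
      (biprod.desc (biproduct.ι (fun _ : Fin (n+1) => U) 0)
        (biproduct.desc fun i : Fin n => biproduct.ι (fun _ : Fin (n+1) => U) i.succ)), ?_⟩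
    rw [biprod.lift_desc, biproduct.lift_desc, ← biproduct.total, Fin.sum_univ_succ]

lemma wide_tors (hA : IsWide A) (hU : U ∈ A) (hgen : A ⊆ gen {U}) : IsTorsionClass (gen {U}) := by
  apply gen_tors
  intro X E Y i p w hS hX hY
  have : Epi p := hS.epi_g
  have e0 : kernel p ≅ X := (kernelIsKernel p).conePointUniqueUpToIso hS.fIsKernel
  have e : X ≅ kernel p := e0.symm
  obtain ⟨n, q, hq⟩ := mem_gen_iff.1 hX
  obtain ⟨m, q', hq'⟩ := mem_gen_iff.1 hY
  obtain ⟨w1, hS1⟩ := pullback_ses p q'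
  have : Epi (q ≫ e.hom) := epi_comp _ _
  obtain ⟨E', i', p', w', t, hS', ht⟩ := exists_ext_lift _ _ w1 hS1 (q ≫ e.hom)
  have hE' : E' ∈ A := hA.ext_mem _ hS' (wide_mul hA hU n) (wide_mul hA hU m)
  exact gen_quot (hgen hE') (t ≫ pullback.fst p q')

lemma wide_aSet (hA : IsWide A) (hU : U ∈ A) (hgen : A ⊆ gen {U}) : aSet (gen {U}) = A := by
  ext B
  constructor
  · rintro ⟨hB, hker⟩
    obtain ⟨n, q, hq⟩ := mem_gen_iff.1 hB
    have h1 : kernel q ∈ gen {U} := hker _ (hgen (wide_mul hA hU n)) q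
    obtain ⟨m, q', hq'⟩ := mem_gen_iff.1 h1
    have h2 := hA.coker_mem _ (wide_mul hA hU m) _ (wide_mul hA hU n) (q' ≫ kernel.ι q)
    have e1 := cokernelEpiComp q' (kernel.ι q)
    have : Epi (Abelian.factorThruCoimage q) := by
      have : Epi (Abelian.coimage.π q ≫ Abelian.factorThruCoimage q) := by
        rw [Abelian.coimage.fac]; exact hq
      exact epi_of_epi (Abelian.coimage.π q) _
    have : IsIso (Abelian.factorThruCoimage q) := isIso_of_mono_of_epi _
    exact wide_iso hA h2 (e1 ≪≫ (asIso (Abelian.factorThruCoimage q))).symm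
  · intro hB
    refine ⟨hgen hB, ?_⟩
    intro Y hY g
    obtain ⟨n, q, hq⟩ := mem_gen_iff.1 hY
    have h1 := hA.ker_mem _ (wide_mul hA hU n) _ hB (q ≫ g)
    have w : (kernel.ι (q ≫ g) ≫ q) ≫ g = 0 := by rw [Category.assoc, kernel.condition]
    have : Epi (kernel.lift g (kernel.ι (q ≫ g) ≫ q) w) := by
      rw [epi_iff_ap]
      intro v y
      obtain ⟨x, hx⟩ := (epi_iff_ap q).1 hq v (ap (kernel.ι g) v y)
      obtain ⟨z, hz⟩ := kernel_lift_elt (q ≫ g) v x (by rw [ap_comp, hx, ap_kernel_cond])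
      refine ⟨z, kernel_ι_inj g v ?_⟩
      rw [← ap_comp, kernel.lift_ι, ap_comp, hz, hx]
    exact gen_quot (hgen h1) (kernel.lift g (kernel.ι (q ≫ g) ≫ q) w)

lemma theta_add {ι : Type} [Fintype ι] (a : ι → ℤ) (α : ι → Q.V → ℤ) (J : Finset Q.V) (b : Q.V → ℤ)
    (x y : Q.V → ℤ) : ((∑ i, a i * euler Q (α i) (x + y)) + ∑ j ∈ J, b j * (x + y) j) =
      ((∑ i, a i * euler Q (α i) x) + ∑ j ∈ J, b j * x j) +
      ((∑ i, a i * euler Q (α i) y) + ∑ j ∈ J, b j * y j) := by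
  simp only [euler_add, Pi.add_apply, mul_add, Finset.sum_add_distrib]
  ring

theorem part2 (hA : IsWide A) (hfd : ∀ X ∈ A, FinDim X) (hfg : IsFinGen A) :
    ∃ c : Q.V → ℤ, A = SemistableSet (fun d => ∑ v : Q.V, c v * d v) := by
  classical
  obtain ⟨U, hU, hgen⟩ := hfg
  let J : Finset Q.V := Finset.univ.filter fun v => Subsingleton (vx U v)
  have hs : Setup (gen {U}) U J :=
    { tors := wide_tors hA hU hgen
      fd := fun X hX => gen_finDim (hfd U hU) hX
      mem := self_mem_gen U
      le := subset_rfl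
      supp := by intro j; simp [J] }
  choose T' i hi using fun v : Q.V => exists_approx hs (PV_proj (k := k) J v)
  have key := thmC hs.tors hs.fd hs.le J (fun j hj => (hs.supp j).1 hj)
    (fun v => cokernel (i v)) (fun v => (hi v).coker_mem hs)
    (fun v X hX => (hi v).extCoker hs (PV_proj J v) hX) (fun _ => 1) (fun _ => zero_le_one)
    (fun _ => -1) (fun _ _ => by norm_num) (fun v _ B hB => (hi v).coker_hom hB)
    (fun N _ hN hNJ hE => isZero_of_PV hNJ fun v =>
      (hi v).homZero hs (PV_proj J v) hN (hE v one_ne_zero))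
  rw [wide_aSet hA hU hgen] at key
  obtain ⟨c, hc⟩ := exists_coeff (Q := Q)
    (fun d => (∑ v, (1:ℤ) * euler Q (dimVec (cokernel (i v))) d) + ∑ j ∈ J, (-1:ℤ) * d j)
    (theta_add (fun _ => 1) (fun v => dimVec (cokernel (i v))) J (fun _ => -1))
  exact ⟨c, key.trans (congrArg SemistableSet hc)⟩

end Part2


section PsiS

lemma bip_eq_zero {C : Type*} [Category C] [Abelian C] {m : ℕ} {f : Fin (m+1) → C} {A : C}
    (x : A ⟶ ⨁ f) (h0 : x ≫ biproduct.π f 0 = 0)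
    (h1 : x ≫ biproduct.lift (fun l : Fin m => biproduct.π f l.succ) = 0) : x = 0 := by
  apply biproduct.hom_ext
  intro j
  rw [zero_comp]
  refine Fin.cases h0 (fun j => ?_) j
  have := h1 =≫ biproduct.π (fun l : Fin m => f l.succ) j
  rwa [Category.assoc, biproduct.lift_π, zero_comp] at this

lemma mono_desc_ker {Z W W' A : RepC k Q} (p : Z ⟶ W) (tl : W ⟶ W') (π : W ⟶ A)
    (hel : ∀ v (x : vx W v), ap tl v x = 0 → ap π v x = 0 → x = 0)
    (i : kernel p ⟶ kernel (p ≫ tl)) (hiι : i ≫ kernel.ι (p ≫ tl) = kernel.ι p)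
    (hd : i ≫ kernel.ι (p ≫ tl) ≫ p ≫ π = 0) : Mono (cokernel.desc i _ hd) := by
  rw [mono_iff_ap]
  intro v
  rw [injective_iff_map_eq_zero]
  intro a ha
  obtain ⟨y, hy⟩ := (epi_iff_ap (cokernel.π i)).1 inferInstance v a
  rw [← hy, ← ap_comp, cokernel.π_desc, ap_comp, ap_comp] at ha
  have h1 : ap p v (ap (kernel.ι (p ≫ tl)) v y) = 0 := by
    apply hel
    · rw [← ap_comp, ap_kernel_cond]
    · exact ha
  obtain ⟨z, hz⟩ := kernel_lift_elt p v _ h1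
  have h2 : ap i v z = y := kernel_ι_inj _ v (by rw [← ap_comp, hiι, hz])
  rw [← hy, ← h2, ap_coker_cond]

lemma psi {T : Set (RepC k Q)} (hT : IsTorsionClass T) {N : RepC k Q}
    (hN : ∀ Y ∈ T, HomZero Y N) : ∀ (m : ℕ) (f : Fin m → RepC k Q)
    (_ : ∀ l, SplitProjIn T (f l) ∨ Ext1Zero (f l) N) (Z : RepC k Q) (_ : Z ∈ T) (p : Z ⟶ ⨁ f)
    (_ : Epi p), HomZero (kernel p) N := by
  intro m
  induction m with
  | zero =>
    intro f hf Z hZ p hp g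
    have h0 : 𝟙 Z ≫ p = 0 := biproduct.hom_ext _ _ fun j => j.elim0
    have h1 := hN Z hZ (kernel.lift p (𝟙 Z) h0 ≫ g)
    have h2 : kernel.ι p ≫ kernel.lift p (𝟙 Z) h0 = 𝟙 _ := by
      rw [← cancel_mono (kernel.ι p), Category.assoc, kernel.lift_ι, Category.comp_id,
        Category.id_comp]
    rw [← Category.id_comp g, ← h2, Category.assoc, h1, comp_zero]
  | succ m ih =>
    intro f hf Z hZ p hp g
    let tl : (⨁ f) ⟶ ⨁ (fun l : Fin m => f l.succ) :=
      biproduct.lift (fun l : Fin m => biproduct.π f l.succ)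
    let jn : (⨁ (fun l : Fin m => f l.succ)) ⟶ ⨁ f :=
      biproduct.desc (fun l : Fin m => biproduct.ι f l.succ)
    have hjt : jn ≫ tl = 𝟙 _ := by
      apply biproduct.hom_ext'
      intro a
      apply biproduct.hom_ext
      intro b
      simp only [jn, tl, Category.assoc, biproduct.ι_desc_assoc, biproduct.lift_π, Category.comp_id]
      by_cases hab : a = b
      · subst hab
        rw [biproduct.ι_π_self, biproduct.ι_π_self]
      · rw [biproduct.ι_π_ne _ hab, biproduct.ι_π_ne _ (fun h => hab (Fin.succ_injective _ h))]
    have hj0 : jn ≫ biproduct.π f 0 = 0 := by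
      apply biproduct.hom_ext'
      intro a
      simp only [jn, biproduct.ι_desc_assoc, comp_zero]
      rw [biproduct.ι_π_ne _ (Fin.succ_ne_zero a)]
    have : Epi tl := (SplitEpi.mk jn hjt).epi
    have e0 : Epi (p ≫ biproduct.π f 0) := epi_comp _ _
    rcases hf 0 with hs | hE
    · obtain ⟨s, hs⟩ := hs.2 Z hZ (p ≫ biproduct.π f 0) e0
      let q := p ≫ biproduct.π f 0
      have hK : kernel q ∈ T := by
        refine hT.summand_mem Z hZ _ ⟨kernel.ι q, kernel.lift q (𝟙 Z - q ≫ s) ?_, ?_⟩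
        · rw [Preadditive.sub_comp, Category.assoc, hs, Category.id_comp, Category.comp_id, sub_self]
        · rw [← cancel_mono (kernel.ι q), Category.assoc, kernel.lift_ι, Preadditive.comp_sub,
            kernel.condition_assoc, zero_comp, sub_zero, Category.comp_id, Category.id_comp]
      have hep : Epi (kernel.ι q ≫ p ≫ tl) := by
        rw [epi_iff_ap]
        intro v y
        obtain ⟨z, hz⟩ := (epi_iff_ap p).1 hp v (ap jn v y)
        obtain ⟨x, hx⟩ := kernel_lift_elt q v z (by
          rw [ap_comp, hz, ← ap_comp, hj0, ap_zero])
        refine ⟨x, ?_⟩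
        rw [ap_comp, ap_comp, hx, hz, ← ap_comp, hjt, ap_id]
      have h1 := ih (fun l => f l.succ) (fun l => hf l.succ) _ hK (kernel.ι q ≫ p ≫ tl) hep
      have hu : (kernel.ι (kernel.ι q ≫ p ≫ tl) ≫ kernel.ι q) ≫ p = 0 := by
        apply bip_eq_zero
        · have := kernel.condition q
          rw [Category.assoc, Category.assoc]
          erw [this]
          rw [comp_zero]
        · have := kernel.condition (kernel.ι q ≫ p ≫ tl)
          simpa only [Category.assoc] using this
      have hv0 : kernel.ι p ≫ q = 0 := by rw [kernel.condition_assoc, zero_comp]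
      have hv : kernel.lift q (kernel.ι p) hv0 ≫ kernel.ι q ≫ p ≫ tl = 0 := by
        rw [kernel.lift_ι_assoc, kernel.condition_assoc, zero_comp]
      have h2 := h1 (kernel.lift p _ hu ≫ g)
      have h3 : kernel.lift _ _ hv ≫ kernel.lift p _ hu = 𝟙 _ := by
        rw [← cancel_mono (kernel.ι p), Category.assoc, kernel.lift_ι, kernel.lift_ι_assoc,
          kernel.lift_ι, Category.id_comp]
      rw [← Category.id_comp g, ← h3, Category.assoc, h2, comp_zero]
    · have hel : ∀ v (x : vx (⨁ f) v), ap tl v x = 0 → ap (biproduct.π f 0) v x = 0 → x = 0 := by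
        intro v x e2 e1
        have e3 : 𝟙 (⨁ f) = biproduct.π f 0 ≫ biproduct.ι f 0 + tl ≫ jn := by
          simp only [tl, jn, biproduct.lift_desc]
          rw [← biproduct.total, Fin.sum_univ_succ]
        have e4 := ap_id (⨁ f) v x
        rw [e3, ap_add, ap_comp, ap_comp, e1, e2, map_zero, map_zero, add_zero] at e4
        exact e4.symm
      have hi : kernel.ι p ≫ p ≫ tl = 0 := by rw [kernel.condition_assoc, zero_comp]
      let i : kernel p ⟶ kernel (p ≫ tl) := kernel.lift _ _ hi
      have hiι : i ≫ kernel.ι (p ≫ tl) = kernel.ι p := kernel.lift_ι _ _ _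
      have : Mono i := by
        have : Mono (i ≫ kernel.ι (p ≫ tl)) := by rw [hiι]; infer_instance
        exact mono_of_mono i (kernel.ι (p ≫ tl))
      have hd : i ≫ kernel.ι (p ≫ tl) ≫ p ≫ biproduct.π f 0 = 0 := by
        rw [← Category.assoc, hiι, kernel.condition_assoc, zero_comp]
      have : Mono (cokernel.desc i _ hd) := mono_desc_ker p tl (biproduct.π f 0) hel i hiι hd
      obtain ⟨g', hg'⟩ := Ext1Zero.extend i (hE.of_mono (cokernel.desc i _ hd)) g
      have := ih (fun l => f l.succ) (fun l => hf l.succ) Z hZ (p ≫ tl) (epi_comp _ _) g'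
      rw [← hg', this, comp_zero]

end PsiS

section Fit

lemma fitting {X : RepC k Q} (hX : Indec X) (hfd : FinDim X) (φ : End X) :
    IsIso (φ : X ⟶ X) ∨ IsNilpotent φ := by
  let S : Set ℕ := {d | ∃ (n : ℕ) (I : RepC k Q) (e : X ⟶ I) (m : I ⟶ X), Epi e ∧ Mono m ∧
    e ≫ m = ((φ ^ (n+1) : End X) : X ⟶ X) ∧ tdim I = d}
  have hne : S.Nonempty := ⟨_, 0, _, Abelian.factorThruImage (φ : X ⟶ X),
    Abelian.image.ι (φ : X ⟶ X), inferInstance, inferInstance, by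
      rw [zero_add, pow_one]; exact Abelian.image.fac _, rfl⟩
  obtain ⟨n, I, e, m, he, hm, hem, hd⟩ := Nat.sInf_mem hne
  have hI : FinDim I := hfd.of_mono m
  have hle : tdim I ≤ tdim (Abelian.image (m ≫ e)) := by
    rw [hd]
    apply Nat.sInf_le
    refine ⟨2*n+1, _, e ≫ Abelian.factorThruImage (m ≫ e), Abelian.image.ι (m ≫ e) ≫ m,
      epi_comp _ _, mono_comp _ _, ?_, rfl⟩
    have h1 : 2 * n + 1 + 1 = (n+1) + (n+1) := by ring
    rw [h1, pow_add, End.mul_def, ← hem]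
    have := Abelian.image.fac (m ≫ e)
    rw [Category.assoc, ← Category.assoc (Abelian.factorThruImage (m ≫ e)), this]
    simp only [Category.assoc]
  have i1 : IsIso (Abelian.image.ι (m ≫ e)) := isIso_of_mono_tdim hI _ hle
  have i2 : IsIso (Abelian.factorThruImage (m ≫ e)) := isIso_of_epi_tdim hI _ hle
  have i3 : IsIso (m ≫ e) := by
    rw [← Abelian.image.fac (m ≫ e)]
    infer_instance
  have hr : m ≫ (e ≫ inv (m ≫ e)) = 𝟙 I := by rw [← Category.assoc, IsIso.hom_inv_id]
  let sp := ShortComplex.Splitting.ofExactOfRetraction _ (ses_coker m).exact _ hr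
    (ses_coker m).epi_g
  rcases hX.2 _ _ sp.isoBinaryBiproduct with h0 | h0
  · right
    refine ⟨n+1, ?_⟩
    have : ((φ ^ (n+1) : End X) : X ⟶ X) = 0 := by
      rw [← hem, h0.eq_of_src m 0, comp_zero]
    exact this
  · left
    have : Epi m := Preadditive.epi_of_isZero_cokernel m h0
    have : IsIso m := isIso_of_mono_of_epi m
    have : IsIso e := IsIso.of_isIso_comp_left m e
    have h2 : IsUnit (φ ^ (n+1) : End X) := by
      rw [isUnit_iff_isIso, ← hem]
      infer_instance
    rw [isUnit_pow_succ_iff, isUnit_iff_isIso] at h2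
    exact h2

lemma local_end {X : RepC k Q} (hX : Indec X) (hfd : FinDim X) (α β : X ⟶ X) (h : α + β = 𝟙 X) :
    IsIso α ∨ IsIso β := by
  rcases fitting hX hfd α with h1 | h1
  · exact Or.inl h1
  · right
    have h2 := h1.isUnit_one_sub
    rw [isUnit_iff_isIso] at h2
    have : ((1 : End X) - (show End X from α) : End X) = (show End X from β) := by
      have h3 : (1 : End X) = (show End X from α) + (show End X from β) := h.symm
      rw [h3]; exact add_sub_cancel_left _ _
    rwa [this] at h2

lemma SplitProjIn.retract {T : Set (RepC k Q)} (hT : IsTorsionClass T) {P X : RepC k Q}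
    (hP : SplitProjIn T P) (a : X ⟶ P) (b : P ⟶ X) (hab : a ≫ b = 𝟙 X) : SplitProjIn T X := by
  refine ⟨hT.summand_mem P hP.1 X ⟨a, b, hab⟩, ?_⟩
  intro Y hY p hp
  have : Epi (biprod.desc (p ≫ a) (𝟙 P - b ≫ a)) := by
    rw [Preadditive.epi_iff_cancel_zero]
    intro Z g hg
    have h1 := biprod.inl ≫= hg
    have h2 := biprod.inr ≫= hg
    rw [biprod.inl_desc_assoc, comp_zero, Category.assoc, ← comp_zero (f := p), cancel_epi] at h1
    rw [biprod.inr_desc_assoc, comp_zero, Preadditive.sub_comp, Category.assoc, h1, comp_zero,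
      sub_zero, Category.id_comp] at h2
    exact h2
  obtain ⟨s, hs⟩ := hP.2 _ (hT.sum_mem _ hY _ hP.1) _ this
  refine ⟨a ≫ s ≫ biprod.fst, ?_⟩
  have h3 : (a ≫ s ≫ biprod.desc (p ≫ a) (𝟙 P - b ≫ a)) ≫ b = 𝟙 X := by
    rw [hs, Category.comp_id, hab]
  rw [biprod.desc_eq] at h3
  simp only [Preadditive.comp_add, Preadditive.add_comp, Preadditive.comp_sub, Preadditive.sub_comp,
    Category.assoc, hab, Category.comp_id, Category.id_comp, sub_self, add_zero] at h3
  simpa only [Category.assoc] using h3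

end Fit

section HB

lemma decomp_aux {C : Type*} [Category C] [Abelian C] {Ω P X T' TΩ : C} (κ : Ω ⟶ P) (e : P ⟶ X) [Epi e]
    (we : κ ≫ e = 0) (hex : ∀ {D : C} (g : P ⟶ D), κ ≫ g = 0 → ∃ j : X ⟶ D, e ≫ j = g)
    (i : P ⟶ T') (iΩ : Ω ⟶ TΩ) (eb : T' ⟶ X) (heb : i ≫ eb = e) (μ : TΩ ⟶ T') (hμ : iΩ ≫ μ = κ ≫ i)
    (hlift : ∀ (F : C) (L : TΩ ⟶ F) (j : X ⟶ cokernel L), ∃ s : X ⟶ F, s ≫ cokernel.π L = j) :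
    ∃ (x : X ⟶ T') (y : T' ⟶ X) (z : X ⟶ cokernel iΩ) (w : cokernel iΩ ⟶ X),
      x ≫ y + z ≫ w = 𝟙 X := by
  have wr : iΩ ≫ (0 : TΩ ⟶ X) = (κ ≫ i) ≫ eb := by
    rw [Category.assoc, heb, we, comp_zero]
  obtain ⟨r, hLr, hRr⟩ : ∃ r : pushout iΩ (κ ≫ i) ⟶ X, pushout.inl iΩ (κ ≫ i) ≫ r = 0 ∧
      pushout.inr iΩ (κ ≫ i) ≫ r = eb :=
    ⟨pushout.desc (0 : TΩ ⟶ X) eb wr, pushout.inl_desc _ _ _, pushout.inr_desc _ _ _⟩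
  obtain ⟨ρ, hLρ, hRρ⟩ : ∃ ρ : pushout iΩ (κ ≫ i) ⟶ T', pushout.inl iΩ (κ ≫ i) ≫ ρ = μ ∧
      pushout.inr iΩ (κ ≫ i) ≫ ρ = 𝟙 T' :=
    ⟨pushout.desc μ (𝟙 T') (by rw [hμ, Category.comp_id]), pushout.inl_desc _ _ _,
      pushout.inr_desc _ _ _⟩
  obtain ⟨q, hLq, hRq⟩ : ∃ q : pushout iΩ (κ ≫ i) ⟶ cokernel iΩ,
      pushout.inl iΩ (κ ≫ i) ≫ q = cokernel.π iΩ ∧ pushout.inr iΩ (κ ≫ i) ≫ q = 0 :=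
    ⟨pushout.desc (cokernel.π iΩ) 0 (by rw [cokernel.condition, comp_zero]), pushout.inl_desc _ _ _,
      pushout.inr_desc _ _ _⟩
  have hext : ∀ {Z : C} (a b : pushout iΩ (κ ≫ i) ⟶ Z),
      pushout.inl iΩ (κ ≫ i) ≫ a = pushout.inl iΩ (κ ≫ i) ≫ b →
      pushout.inr iΩ (κ ≫ i) ≫ a = pushout.inr iΩ (κ ≫ i) ≫ b → a = b :=
    fun a b h1 h2 => pushout.hom_ext h1 h2
  have hc : iΩ ≫ pushout.inl iΩ (κ ≫ i) = (κ ≫ i) ≫ pushout.inr iΩ (κ ≫ i) := pushout.condition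
  generalize pushout.inl iΩ (κ ≫ i) = L at *
  generalize pushout.inr iΩ (κ ≫ i) = R at *
  generalize pushout iΩ (κ ≫ i) = F at *
  have wj : κ ≫ (i ≫ R ≫ cokernel.π L) = 0 := by
    have := hc =≫ cokernel.π L
    rw [Category.assoc, cokernel.condition, comp_zero] at this
    simpa only [Category.assoc] using this.symm
  obtain ⟨j, hj⟩ := hex _ wj
  have hδ : cokernel.π L ≫ cokernel.desc L r hLr = r := cokernel.π_desc _ _ _
  have hjδ : j ≫ cokernel.desc L r hLr = 𝟙 X := by
    rw [← cancel_epi e, ← Category.assoc, hj, Category.assoc, Category.assoc, hδ, hRr, heb,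
      Category.comp_id]
  obtain ⟨s, hs⟩ := hlift F L j
  have hsr : s ≫ r = 𝟙 X := by rw [← hδ, ← Category.assoc, hs, hjδ]
  have wσ : iΩ ≫ (L - μ ≫ R) = 0 := by
    rw [Preadditive.comp_sub, hc, ← Category.assoc, hμ, sub_self]
  have hid : ρ ≫ R + q ≫ cokernel.desc iΩ _ wσ = 𝟙 _ := by
    apply hext
    · rw [Preadditive.comp_add, ← Category.assoc, hLρ, ← Category.assoc, hLq, cokernel.π_desc,
        Category.comp_id]
      exact add_sub_cancel _ _
    · rw [Preadditive.comp_add, ← Category.assoc, hRρ, ← Category.assoc, hRq, zero_comp,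
        Category.comp_id, Category.id_comp, add_zero]
  refine ⟨s ≫ ρ, R ≫ r, s ≫ q, cokernel.desc iΩ _ wσ ≫ r, ?_⟩
  have : s ≫ (ρ ≫ R + q ≫ cokernel.desc iΩ _ wσ) ≫ r = 𝟙 X := by rw [hid, Category.id_comp, hsr]
  rw [← this]
  simp only [Preadditive.comp_add, Preadditive.add_comp, Category.assoc]

variable {T : Set (RepC k Q)} {U : RepC k Q} {J : Finset Q.V}

lemma decomp_id (h : Setup T U J) {X : RepC k Q} (hX : X ∈ T) (hE : ∀ Y ∈ T, Ext1Zero X Y) :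
    ∃ (T' : RepC k Q) (_ : SplitProjIn T T') (P T2 : RepC k Q) (i2 : P ⟶ T2) (_ : IsApp T i2)
      (x : X ⟶ T') (y : T' ⟶ X) (z : X ⟶ cokernel i2) (w : cokernel i2 ⟶ X),
      x ≫ y + z ≫ w = 𝟙 X := by
  obtain ⟨P, e, hP, he⟩ := enough_proj (J := J) ⟨h.fd X hX, h.sup hX⟩
  have hΩ := hP.of_mono (kernel.ι e)
  obtain ⟨T', i, hi⟩ := exists_approx h hP
  obtain ⟨TΩ, iΩ, hiΩ⟩ := exists_approx h hΩ
  obtain ⟨eb, heb⟩ := hi.ext X hX e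
  obtain ⟨μ, hμ⟩ := hiΩ.ext T' hi.mem (kernel.ι e ≫ i)
  refine ⟨T', hi.split h hP, _, _, iΩ, hiΩ, ?_⟩
  refine decomp_aux (kernel.ι e) e (kernel.condition e)
    (fun g hg => ⟨Abelian.epiDesc e g hg, Abelian.comp_epiDesc _ _ _⟩) i iΩ eb heb μ hμ ?_
  intro F L j
  have hk : kernel (cokernel.π L) ∈ T :=
    h.tors.quot_mem _ hiΩ.mem _ (Abelian.factorThruImage L) inferInstance
  exact Ext1Zero.lift (cokernel.π L) (hE _ hk) j

lemma homZero_nonsplit (h : Setup T U J) {X : RepC k Q} (hX : X ∈ T) (hI : Indec X)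
    (hE : ∀ Y ∈ T, Ext1Zero X Y) (hns : ¬ SplitProjIn T X) {B : RepC k Q} (hB : B ∈ aSet T) :
    HomZero X B := by
  obtain ⟨T', hT', P, T2, i2, hi2, x, y, z, w, hxy⟩ := decomp_id h hX hE
  rcases local_end hI (h.fd X hX) _ _ hxy with h1 | h1
  · refine absurd (hT'.retract h.tors (inv (x ≫ y) ≫ x) y ?_) hns
    rw [Category.assoc, IsIso.inv_hom_id]
  · intro f
    rw [← cancel_epi (z ≫ w), Category.assoc, hi2.coker_hom hB (w ≫ f), comp_zero, comp_zero]

end HB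


section Part1

lemma ext_gen {U : RepC k Q} (hU : Ext1Zero U U) {X : RepC k Q} (hX : X ∈ gen {U}) :
    Ext1Zero U X := by
  obtain ⟨n, p, hp⟩ := mem_gen_iff.1 hX
  exact (Ext1Zero.biproduct_right (fun _ : Fin n => U) fun _ => hU).of_epi p

lemma tilt_tors {U : RepC k Q} (hU : Ext1Zero U U) : IsTorsionClass (gen {U}) := by
  apply gen_tors
  intro X E Y i p w hS hX hY
  have : Epi p := hS.epi_g
  have e : kernel p ≅ X := (kernelIsKernel p).conePointUniqueUpToIso hS.fIsKernel
  obtain ⟨n, g, hg⟩ := of_mem_gen hX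
  obtain ⟨m, g', hg'⟩ := of_mem_gen hY
  choose l hl using fun j => Ext1Zero.lift p ((ext_gen hU hX).of_iso_right e) (g' j)
  refine mem_gen_of (ι := Fin n ⊕ Fin m) (Sum.elim (fun a => g a ≫ i) l) ?_
  intro Z f h
  have h1 : i ≫ f = 0 := hg _ _ fun a => by simpa using h (Sum.inl a)
  obtain ⟨f', hf'⟩ := hS.exact.desc' f h1
  dsimp at hf'
  have h2 : f' = 0 := hg' _ _ fun b => by
    have := h (Sum.inr b)
    rw [← hl, Category.assoc, hf']; exact this
  rw [← hf', h2, comp_zero]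

lemma addSet_retract {r : ℕ} {Tt : Fin r → RepC k Q} {X : RepC k Q} (hX : X ∈ addSet {⨁ Tt}) :
    ∃ (m : ℕ) (c : Fin m → Fin r) (s : X ⟶ ⨁ fun l => Tt (c l)) (ρ : (⨁ fun l => Tt (c l)) ⟶ X),
      s ≫ ρ = 𝟙 X := by
  obtain ⟨n, f, hf, i, t, hit⟩ := hX
  obtain rfl : f = fun _ => ⨁ Tt := funext fun a => hf a
  let c : Fin (n * r) → Fin r := fun l => (finProdFinEquiv.symm l).2
  refine ⟨n * r, c,
    i ≫ biproduct.lift (fun l => biproduct.π (fun _ : Fin n => ⨁ Tt) (finProdFinEquiv.symm l).1 ≫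
      biproduct.π Tt (c l)),
    biproduct.desc (fun l => biproduct.ι Tt (c l) ≫
      biproduct.ι (fun _ : Fin n => ⨁ Tt) (finProdFinEquiv.symm l).1) ≫ t, ?_⟩
  have h : (biproduct.lift (fun l => biproduct.π (fun _ : Fin n => ⨁ Tt) (finProdFinEquiv.symm l).1 ≫
      biproduct.π Tt (c l))) ≫ biproduct.desc (fun l => biproduct.ι Tt (c l) ≫
      biproduct.ι (fun _ : Fin n => ⨁ Tt) (finProdFinEquiv.symm l).1) = 𝟙 _ := by
    rw [biproduct.lift_desc]
    rw [← Equiv.sum_comp finProdFinEquiv]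
    simp only [c, Equiv.symm_apply_apply, Category.assoc]
    rw [Fintype.sum_prod_type, ← biproduct.total]
    refine Finset.sum_congr rfl fun a _ => ?_
    have h2 := biproduct.total (f := Tt)
    have h3 : biproduct.π (fun _ : Fin n => ⨁ Tt) a ≫ (∑ b, biproduct.π Tt b ≫ biproduct.ι Tt b) ≫
      biproduct.ι (fun _ : Fin n => ⨁ Tt) a = biproduct.π (fun _ : Fin n => ⨁ Tt) a ≫
      biproduct.ι (fun _ : Fin n => ⨁ Tt) a := by
        rw [h2, Category.id_comp]
    rw [← h3]
    simp only [Preadditive.comp_sum, Preadditive.sum_comp, Category.assoc]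
    refine Finset.sum_congr rfl fun x _ => ?_
    have h4 : ∀ y : Fin r, y = x → biproduct.π (fun _ : Fin n => ⨁ Tt) a ≫ biproduct.π Tt y ≫
        biproduct.ι Tt y ≫ biproduct.ι (fun _ : Fin n => ⨁ Tt) a =
        biproduct.π (fun _ : Fin n => ⨁ Tt) a ≫ biproduct.π Tt x ≫
        biproduct.ι Tt x ≫ biproduct.ι (fun _ : Fin n => ⨁ Tt) a := by
      rintro y rfl
      rfl
    exact h4 _ (by rw [Equiv.symm_apply_apply])
  rw [Category.assoc, ← Category.assoc _ _ t, h, Category.id_comp, hit]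

lemma hom_zero_cores {T : Set (RepC k Q)} (hT : IsTorsionClass T) {N : RepC k Q}
    (hN : ∀ Y ∈ T, HomZero Y N) {m : ℕ} (f : Fin m → RepC k Q) (hW : (⨁ f) ∈ T)
    (hf : ∀ l, SplitProjIn T (f l) ∨ Ext1Zero (f l) N) {P T' T'' : RepC k Q} (hT' : T' ∈ T)
    (s : T'' ⟶ ⨁ f) (ρ : (⨁ f) ⟶ T'') (hs : s ≫ ρ = 𝟙 _) (i : P ⟶ T') (p : T' ⟶ T'')
    (w : i ≫ p = 0) (hS : (ShortComplex.mk i p w).ShortExact) : HomZero P N := by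
  intro g
  have : Epi p := hS.epi_g
  have : Mono i := hS.mono_f
  have : Epi ρ := (SplitEpi.mk s hs).epi
  have hk : kernel ρ ∈ T := by
    refine hT.summand_mem _ hW _ ⟨kernel.ι ρ, kernel.lift ρ (𝟙 _ - ρ ≫ s) ?_, ?_⟩
    · rw [Preadditive.sub_comp, Category.assoc, hs, Category.id_comp, Category.comp_id, sub_self]
    · rw [← cancel_mono (kernel.ι ρ), Category.assoc, kernel.lift_ι, Preadditive.comp_sub,
        kernel.condition_assoc, zero_comp, sub_zero, Category.comp_id, Category.id_comp]
  have hZ := hT.pullback_mem ρ p hk hT'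
  have h1 := psi hT hN m f hf _ hZ (pullback.fst ρ p) inferInstance
  have hw : (kernel.ι (pullback.fst ρ p) ≫ pullback.snd ρ p) ≫ p = 0 := by
    rw [Category.assoc, ← pullback.condition, kernel.condition_assoc, zero_comp]
  obtain ⟨v, hv⟩ := hS.exact.lift' _ hw
  dsimp at hv
  have hu0 : (0 : P ⟶ ⨁ f) ≫ ρ = i ≫ p := by rw [w, zero_comp]
  have hu : pullback.lift (0 : P ⟶ ⨁ f) i hu0 ≫ pullback.fst ρ p = 0 := pullback.lift_fst _ _ _
  have huv : kernel.lift _ _ hu ≫ v = 𝟙 P := by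
    rw [← cancel_mono i, Category.assoc, hv, kernel.lift_ι_assoc, pullback.lift_snd,
      Category.id_comp]
  rw [← Category.id_comp g, ← huv, Category.assoc, h1 (v ≫ g), comp_zero]

theorem part1 (r : ℕ) (Tt : Fin r → RepC k Q)
    (hfd : ∀ i, FinDim (Tt i)) (hindec : ∀ i, Indec (Tt i))
    (hst : IsSupportTilting (⨁ Tt))
    (a : Fin r → ℤ)
    (ha0 : ∀ i, SplitProjIn (gen ({⨁ Tt} : Set (RepC k Q))) (Tt i) → a i = 0)
    (hapos : ∀ i, ¬ SplitProjIn (gen ({⨁ Tt} : Set (RepC k Q))) (Tt i) → 0 < a i)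
    (J : Finset Q.V)
    (hJ : ∀ j : Q.V, j ∈ J ↔ IsZero ((⨁ Tt : RepC k Q).obj ((Paths.of Q.V).obj j)))
    (b : Q.V → ℤ) (hb : ∀ j ∈ J, b j < 0) :
    aSet (gen ({⨁ Tt} : Set (RepC k Q))) =
      SemistableSet (fun d =>
        (∑ i : Fin r, a i * euler Q (dimVec (Tt i)) d) + ∑ j ∈ J, b j * d j) := by
  have hTT : Ext1Zero (⨁ Tt) (⨁ Tt) := hst.1
  have hfT : FinDim (⨁ Tt) := hst.2.1.1
  have hs : Setup (gen {⨁ Tt}) (⨁ Tt) J :=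
    { tors := tilt_tors hTT
      fd := fun X hX => gen_finDim hfT hX
      mem := self_mem_gen _
      le := subset_rfl
      supp := fun j => (hJ j).trans ModuleCat.isZero_iff_subsingleton }
  have hmem : ∀ i, Tt i ∈ gen {⨁ Tt} := fun i =>
    gen_quot (self_mem_gen (⨁ Tt)) (biproduct.π Tt i)
  have hext : ∀ i, ∀ X ∈ gen {⨁ Tt}, Ext1Zero (Tt i) X := fun i X hX =>
    (ext_gen hTT hX).of_mono (biproduct.ι Tt i)
  refine thmC hs.tors hs.fd hs.le J (fun j hj => (hs.supp j).1 hj) Tt hmem hext a ?_ b hb ?_ ?_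
  · intro i
    by_cases h : SplitProjIn (gen ({⨁ Tt} : Set (RepC k Q))) (Tt i)
    · exact (ha0 i h).ge
    · exact (hapos i h).le
  · intro i hi B hB
    exact homZero_nonsplit hs (hmem i) (hindec i) (hext i) (fun h => hi (ha0 i h)) hB
  · intro N hNfd hN hNJ hE
    refine isZero_of_PV hNJ fun v => ?_
    have hP : SplitProjIn {M : RepC k Q | FinDim M ∧ SuppLE M (⨁ Tt)} (PV k J v) := by
      refine ⟨⟨(PV_inA J v).1, suppLE_iff.2 fun j hj => (PV_inA J v).2 j ((hs.supp j).2 hj)⟩, ?_⟩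
      intro X hX p hp
      exact PV_section (fun j hj => suppLE_iff.1 hX.2 j ((hs.supp j).1 hj)) p
    obtain ⟨T', T'', hT', hT'', i, p, w, hS⟩ := hst.2.2.2 _ hP
    obtain ⟨m, c, s, ρ, hsρ⟩ := addSet_retract hT''
    have hT'm : T' ∈ gen {⨁ Tt} := ⟨T', hT', 𝟙 _, inferInstance⟩
    have hW : (⨁ fun l => Tt (c l)) ∈ gen {⨁ Tt} := by
      refine mem_gen_of (ι := Fin m) (fun l => biproduct.π Tt (c l) ≫
        biproduct.ι (fun l => Tt (c l)) l) ?_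
      intro Z f hf
      apply biproduct.hom_ext'
      intro l
      rw [comp_zero, ← cancel_epi (biproduct.π Tt (c l)), ← Category.assoc, hf l, comp_zero]
    refine hom_zero_cores hs.tors hN (fun l => Tt (c l)) hW ?_ hT'm s ρ hsρ i p w hS
    intro l
    by_cases h : SplitProjIn (gen ({⨁ Tt} : Set (RepC k Q))) (Tt (c l))
    · exact Or.inl h
    · exact Or.inr (hE _ (hapos _ h).ne')

end Part1


/-- Let `T = T₁ ⊕ ⋯ ⊕ T_r` be a basic support tilting object of
`rep Q` and let `θ = ∑ aᵢ dᵢ + ∑_{j ∉ supp T} bⱼ eⱼ`, where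
`dᵢ(dim M) = dim Hom(Tᵢ, M) − dim Ext¹(Tᵢ, M) = ⟨dim Tᵢ, dim M⟩` is the Euler
pairing against `dim Tᵢ`, `eⱼ(dim M) = dim M_j`, with `aᵢ = 0` whenever `Tᵢ` is split
projective in `Gen T`, `aᵢ > 0` whenever `Tᵢ` is not split projective, and `bⱼ < 0`
for all vertices `j` not in the support of `T`.  Then `a(Gen T)` equals the category
of `θ`-semistable representations.  In particular every finitely generated wide
subcategory of `rep Q` is the semistable subcategory of some stability condition. -/
theorem statement13 (k : Type) [Field k] [IsAlgClosed k] (Q : FinQuiver)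
    (r : ℕ) (Tt : Fin r → RepC k Q)
    (hfd : ∀ i, FinDim (Tt i)) (hindec : ∀ i, Indec (Tt i))
    (hbasic : ∀ i j, Nonempty (Tt i ≅ Tt j) → i = j)
    (hst : IsSupportTilting (⨁ Tt))
    (a : Fin r → ℤ)
    (ha0 : ∀ i, SplitProjIn (gen ({⨁ Tt} : Set (RepC k Q))) (Tt i) → a i = 0)
    (hapos : ∀ i, ¬ SplitProjIn (gen ({⨁ Tt} : Set (RepC k Q))) (Tt i) → 0 < a i)
    (J : Finset Q.V)
    (hJ : ∀ j : Q.V, j ∈ J ↔ IsZero ((⨁ Tt : RepC k Q).obj ((Paths.of Q.V).obj j)))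
    (b : Q.V → ℤ) (hb : ∀ j ∈ J, b j < 0) :
    aSet (gen ({⨁ Tt} : Set (RepC k Q))) =
      SemistableSet (fun d =>
        (∑ i : Fin r, a i * euler Q (dimVec (Tt i)) d) + ∑ j ∈ J, b j * d j) ∧
    (∀ A : Set (RepC k Q), IsWide A → (∀ X ∈ A, FinDim X) → IsFinGen A →
      ∃ c : Q.V → ℤ, A = SemistableSet (fun d => ∑ v : Q.V, c v * d v)) := by
  exact ⟨part1 r Tt hfd hindec hst a ha0 hapos J hJ b hb, fun A hA h1 h2 => part2 hA h1 h2⟩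

end Statement13
end NCPaper
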